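/- arXiv:1205.1558 — 7 statements merged into one kernel-verified Lean document; each statement's English description precedes it below -/
import Mathlib

section
/- For every integer n > 1.2·10⁵, every (10⁻⁴)-dense partial latin square of order n has a completion to a latin square of order n. -/
/-- A partial latin square of order `n`: each symbol occurs at most once in
each row and at most once in each column. -/
def IsPartialLatinSquare {n : ℕ} (P : Fin n → Fin n → Option (Fin n)) : Prop :=
  (∀ i j j' s, P i j = some s → P i j' = some s → j = j') ∧
  (∀ i i' j s, P i j = some s → P i' j = some s → i = i')

/-- `P` is `ε`-dense: every row, column, and symbol of `P` has at most `ε * n`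
filled cells. -/
def IsEpsDense {n : ℕ} (ε : ℝ) (P : Fin n → Fin n → Option (Fin n)) : Prop :=
  (∀ i, ((Finset.univ.filter fun j => (P i j).isSome).card : ℝ) ≤ ε * n) ∧
  (∀ j, ((Finset.univ.filter fun i => (P i j).isSome).card : ℝ) ≤ ε * n) ∧
  (∀ s, ((Finset.univ.filter fun p : Fin n × Fin n => P p.1 p.2 = some s).card : ℝ) ≤ ε * n)

/-- A latin square of order `n`: every row and every column contains each
symbol exactly once. -/
def IsLatinSquare {n : ℕ} (L : Fin n → Fin n → Fin n) : Prop :=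
  (∀ i, Function.Bijective (L i)) ∧ (∀ j, Function.Bijective fun i => L i j)

/-- `L` completes `P`. -/
def Completes {n : ℕ} (L : Fin n → Fin n → Fin n)
    (P : Fin n → Fin n → Option (Fin n)) : Prop :=
  ∀ i j s, P i j = some s → L i j = s

/-- The number of filled cells of a partial latin square. -/
def filledCells {n : ℕ} (P : Fin n → Fin n → Option (Fin n)) : ℕ :=
  (Finset.univ.filter fun p : Fin n × Fin n => P p.1 p.2 ≠ none).card

set_option linter.unusedTactic false
set_option linter.unreachableTactic false
set_option linter.unusedVariables false
set_option linter.all false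
namespace PLS
open Finset

/-- A latin square with its three "division" operations. -/
structure LS (α : Type) where
  S : α → α → α
  C : α → α → α
  R : α → α → α
  SC : ∀ i s, S i (C i s) = s
  CS : ∀ i j, C i (S i j) = j
  SR : ∀ j s, S (R j s) j = s
  RS : ∀ i j, R j (S i j) = i
  CR : ∀ j s, C (R j s) s = j
  RC : ∀ i s, R (C i s) s = i

attribute [simp] LS.SC LS.CS LS.SR LS.RS LS.CR LS.RC

def prc {α : Type} (t : α × α × α) : α × α := (t.1, t.2.1)
def prs {α : Type} (t : α × α × α) : α × α := (t.1, t.2.2)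
def pcs {α : Type} (t : α × α × α) : α × α := (t.2.1, t.2.2)

def Bd {α : Type} (M N : Multiset (α × α × α)) : Prop :=
  M.map prc = N.map prc ∧ M.map prs = N.map prs ∧ M.map pcs = N.map pcs

theorem Bd.refl {α : Type} (M : Multiset (α × α × α)) : Bd M M := ⟨rfl, rfl, rfl⟩

theorem Bd.add {α : Type} {M N M' N' : Multiset (α × α × α)} (h : Bd M N) (h' : Bd M' N') :
    Bd (M + M') (N + N') := by
  obtain ⟨a, b, c⟩ := h
  obtain ⟨a', b', c'⟩ := h'
  refine ⟨?_, ?_, ?_⟩ <;> simp [*]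

theorem Bd.trans {α : Type} {M N K : Multiset (α × α × α)} (h : Bd M N) (h' : Bd N K) :
    Bd M K := ⟨h.1.trans h'.1, h.2.1.trans h'.2.1, h.2.2.trans h'.2.2⟩

def LS.tr {α : Type} (L : LS α) (p : α × α) : α × α × α := (p.1, p.2, L.S p.1 p.2)

theorem exists_unique_of_map {β γ : Type} [Fintype γ] {M : Multiset β} {f : β → γ}
    (h : M.map f = (univ : Finset γ).val) (c : γ) :
    ∃ t ∈ M, f t = c := by
  have : c ∈ M.map f := by rw [h]; exact Finset.mem_univ c
  simpa using this

theorem inj_of_map {β γ : Type} [Fintype γ] {M : Multiset β} {f : β → γ}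
    (h : M.map f = (univ : Finset γ).val) {x y : β} (hx : x ∈ M) (hy : y ∈ M) (e : f x = f y) :
    x = y := by
  have : (M.map f).Nodup := by rw [h]; exact univ.nodup
  exact Multiset.inj_on_of_nodup_map this x hx y hy e

theorem univ_map_bij {γ : Type} [Fintype γ] (f : γ → γ) (g : γ → γ) (h : ∀ x, g (f x) = x) :
    (univ : Finset γ).val.map f = (univ : Finset γ).val := by
  classical
  have hinj : Function.Injective f := Function.LeftInverse.injective h
  have : Function.Bijective f := Finite.injective_iff_bijective.mp hinj
  have h2 := Finset.map_univ_equiv (Equiv.ofBijective f this)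
  have h3 := congrArg Finset.val h2
  rw [Finset.map_val] at h3
  exact h3

theorem trade {α : Type} [Fintype α] [DecidableEq α] (L : LS α) (W : Multiset (α × α))
    (hW : W.Nodup) (Add : Multiset (α × α × α)) (h : Bd (W.map L.tr) Add) :
    ∃ L' : LS α, (∀ i j, (i, j) ∉ W → L'.S i j = L.S i j) ∧
      ∀ t ∈ Add, L'.S t.1 t.2.1 = t.2.2 := by
  classical
  set Ml : Multiset (α × α × α) := (univ : Finset (α × α)).val.map L.tr with hMl
  have hle : W.map L.tr ≤ Ml := Multiset.map_le_map
    ((Multiset.le_iff_subset hW).2 (fun x _ => Finset.mem_univ x))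
  set M' := Ml - W.map L.tr + Add with hM'
  have hsum : M' + W.map L.tr = Ml + Add := by
    rw [hM', add_right_comm, Multiset.sub_add_cancel hle]
  have key : ∀ f : α × α × α → α × α, (W.map L.tr).map f = Add.map f →
      M'.map f = Ml.map f := by
    intro f hf
    have := congrArg (Multiset.map f) hsum
    rw [Multiset.map_add f M', Multiset.map_add f Ml, hf] at this
    exact add_right_cancel this
  have e1 : M'.map prc = (univ : Finset (α × α)).val := by
    rw [key _ h.1, hMl, Multiset.map_map]
    exact univ_map_bij _ id (fun x => rfl)
  have e2 : M'.map prs = (univ : Finset (α × α)).val := by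
    rw [key _ h.2.1, hMl, Multiset.map_map]
    exact univ_map_bij _ (fun p => (p.1, L.C p.1 p.2)) (fun x => by simp [prs, LS.tr])
  have e3 : M'.map pcs = (univ : Finset (α × α)).val := by
    rw [key _ h.2.2, hMl, Multiset.map_map]
    exact univ_map_bij _ (fun p => (L.R p.1 p.2, p.1)) (fun x => by simp [pcs, LS.tr])
  have x1 : ∀ i j, ∃ s, (i, j, s) ∈ M' := by
    intro i j
    obtain ⟨⟨a, b, c⟩, ht, he⟩ := exists_unique_of_map e1 (i, j)
    simp only [prc, Prod.mk.injEq] at he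
    exact ⟨c, by rw [← he.1, ← he.2]; exact ht⟩
  have x2 : ∀ i s, ∃ j, (i, j, s) ∈ M' := by
    intro i j
    obtain ⟨⟨a, b, c⟩, ht, he⟩ := exists_unique_of_map e2 (i, j)
    simp only [prs, Prod.mk.injEq] at he
    exact ⟨b, by rw [← he.1, ← he.2]; exact ht⟩
  have x3 : ∀ j s, ∃ i, (i, j, s) ∈ M' := by
    intro i j
    obtain ⟨⟨a, b, c⟩, ht, he⟩ := exists_unique_of_map e3 (i, j)
    simp only [pcs, Prod.mk.injEq] at he
    exact ⟨a, by rw [← he.1, ← he.2]; exact ht⟩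
  choose S hS using x1
  choose C hC using x2
  choose R hR using x3
  have u1 : ∀ i j s, (i, j, s) ∈ M' → S i j = s := by
    intro i j s hs
    have := inj_of_map e1 (hS i j) hs rfl
    simpa using this
  have u2 : ∀ i j s, (i, j, s) ∈ M' → C i s = j := by
    intro i j s hs
    have := inj_of_map e2 (hC i s) hs rfl
    simpa using this
  have u3 : ∀ i j s, (i, j, s) ∈ M' → R j s = i := by
    intro i j s hs
    have := inj_of_map e3 (hR j s) hs rfl
    simpa using this
  refine ⟨⟨S, C, R, fun i s => u1 _ _ _ (hC i s), fun i j => u2 _ _ _ (hS i j),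
    fun j s => u1 _ _ _ (hR j s), fun i j => u3 _ _ _ (hS i j),
    fun j s => u2 _ _ _ (hR j s), fun i s => u3 _ _ _ (hC i s)⟩, ?_, ?_⟩
  · intro i j hij
    apply u1
    rw [hM', Multiset.mem_add]
    left
    have h1 : L.tr (i, j) ∈ Ml := Multiset.mem_map_of_mem _ (Finset.mem_univ _)
    have h2 : L.tr (i, j) ∉ W.map L.tr := by
      intro hc
      obtain ⟨p, hp, he⟩ := Multiset.mem_map.1 hc
      simp only [LS.tr, Prod.mk.injEq] at he
      apply hij
      have : p = (i, j) := Prod.ext he.1 he.2.1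
      rwa [← this]
    have h3 : L.tr (i, j) ∈ Ml - W.map L.tr + W.map L.tr := by
      rw [Multiset.sub_add_cancel hle]; exact h1
    rcases Multiset.mem_add.1 h3 with h | h
    · exact h
    · exact absurd h h2
  · intro t ht
    exact u1 _ _ _ (by rw [hM', Multiset.mem_add]; right; exact ht)
end PLS

namespace PLS
open Finset

structure Inv {α : Type} (L : LS α) (F : Finset (α × α)) (pr pc ps : α → Bool) : Prop where
  a : ∀ i j, (i, j) ∉ F → ps (L.S i j) = xor (pr i) (pc j)
  b : ∀ i j i' j', (i, j) ∉ F → (i, j') ∉ F → (i', j) ∉ F → (i', j') ∉ F →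
    L.S i j' = L.S i' j → pr i ≠ pr i' → L.S i' j' = L.S i j

theorem Inv.mono {α : Type} {L L' : LS α} {F F' : Finset (α × α)} {pr pc ps : α → Bool}
    (h : Inv L F pr pc ps) (hF : F ⊆ F') (hL : ∀ i j, (i, j) ∉ F' → L'.S i j = L.S i j) :
    Inv L' F' pr pc ps := by
  refine ⟨fun i j hij => ?_, fun i j i' j' h1 h2 h3 h4 h5 h6 => ?_⟩
  · rw [hL _ _ hij]; exact h.a i j (fun hc => hij (hF hc))
  · rw [hL _ _ h4, hL _ _ h1]
    rw [hL _ _ h2, hL _ _ h3] at h5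
    exact h.b i j i' j' (fun hc => h1 (hF hc)) (fun hc => h2 (hF hc)) (fun hc => h3 (hF hc))
      (fun hc => h4 (hF hc)) h5 h6

def Ts {α : Type} (L : LS α) (t : α × α × α) : List (α × α) :=
  [(t.1, t.2.1), (t.1, L.C t.1 t.2.2), (L.R t.2.1 t.2.2, t.2.1)]

def ints {α : Type} (L : LS α) (t : α × α × α) (r : α) : List (α × α) :=
  [(r, t.2.1), (r, L.C r t.2.2), (L.R t.2.1 t.2.2, L.C r t.2.2),
   (r, L.C r (L.S t.1 t.2.1)), (t.1, L.C r (L.S t.1 t.2.1)),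
   (L.R (L.C r (L.S t.1 t.2.1)) t.2.2, L.C r (L.S t.1 t.2.1)),
   (L.R (L.C r (L.S t.1 t.2.1)) t.2.2, L.C t.1 t.2.2)]

def freeRows {α : Type} [Fintype α] [DecidableEq α] (L : LS α) (F : Finset (α × α)) (pr : α → Bool)
    (t : α × α × α) : Finset α :=
  univ.filter fun r => pr r ≠ pr (L.R t.2.1 t.2.2) ∧ ∀ p ∈ ints L t r, p ∉ F

def Good {α : Type} [Fintype α] [DecidableEq α] (L : LS α) (F : Finset (α × α)) (pr : α → Bool)
    (t : α × α × α) : Prop :=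
  L.S t.1 t.2.1 ≠ t.2.2 ∧ (∀ p ∈ Ts L t, p ∉ F) ∧ 500 ≤ (freeRows L F pr t).card

theorem card_inj_le {α β : Type} [Fintype α] [DecidableEq α] [DecidableEq β] (f : α → β) (hf : Function.Injective f)
    (X : Finset β) : (univ.filter fun r => f r ∈ X).card ≤ X.card := by
  apply Finset.card_le_card_of_injOn f
  · intro x hx
    simpa using hx
  · exact hf.injOn

theorem LS.C_inj {α : Type} (L : LS α) (s : α) : Function.Injective (fun r => L.C r s) := by
  intro a b h
  simp only at h
  rw [← L.RC a s, h, L.RC]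

theorem LS.R_inj {α : Type} (L : LS α) (s : α) : Function.Injective (fun r => L.R r s) := by
  intro a b h
  simp only at h
  rw [← L.CR a s, h, L.CR]

theorem exists_row {α : Type} [Fintype α] [DecidableEq α] (L : LS α) (F : Finset (α × α))
    (pr : α → Bool) (t : α × α × α) (hg : Good L F pr t) (X : Finset (α × α)) (hX : X.card ≤ 68)
    (r1 r2 r3 : α) :
    ∃ r ∈ freeRows L F pr t, r ≠ r1 ∧ r ≠ r2 ∧ r ≠ r3 ∧ ∀ p ∈ ints L t r, p ∉ X := by
  by_contra hcon
  push Not at hcon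
  have hsub : freeRows L F pr t ⊆ {r1, r2, r3} ∪
      ((univ.filter fun r => (r, t.2.1) ∈ X) ∪
      ((univ.filter fun r => (r, L.C r t.2.2) ∈ X) ∪
      ((univ.filter fun r => (L.R t.2.1 t.2.2, L.C r t.2.2) ∈ X) ∪
      ((univ.filter fun r => (r, L.C r (L.S t.1 t.2.1)) ∈ X) ∪
      ((univ.filter fun r => (t.1, L.C r (L.S t.1 t.2.1)) ∈ X) ∪
      ((univ.filter fun r => (L.R (L.C r (L.S t.1 t.2.1)) t.2.2, L.C r (L.S t.1 t.2.1)) ∈ X) ∪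
      ((univ.filter fun r => (L.R (L.C r (L.S t.1 t.2.1)) t.2.2, L.C t.1 t.2.2) ∈ X)))))))) := by
    intro r hr
    by_cases h1 : r = r1
    · simp [h1]
    by_cases h2 : r = r2
    · simp [h2]
    by_cases h3 : r = r3
    · simp [h3]
    obtain ⟨p, hp, hpX⟩ := hcon r hr h1 h2 h3
    simp only [ints, List.mem_cons, List.not_mem_nil, or_false] at hp
    simp only [Finset.mem_union, Finset.mem_filter, Finset.mem_univ, true_and]
    rcases hp with h | h | h | h | h | h | h <;> rw [h] at hpX <;> simp [hpX]
  have hc := (Finset.card_le_card hsub)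
  have i0 : ({r1, r2, r3} : Finset α).card ≤ 3 := Finset.card_le_three
  have i1 := card_inj_le (fun r => (r, t.2.1)) (fun a b h => by simpa using h) X
  have i2 := card_inj_le (fun r => (r, L.C r t.2.2)) (fun a b h => by
    simp only [Prod.mk.injEq] at h; exact h.1) X
  have i3 := card_inj_le (fun r => (L.R t.2.1 t.2.2, L.C r t.2.2)) (fun a b h => by
    simp only [Prod.mk.injEq] at h; exact L.C_inj _ h.2) X
  have i4 := card_inj_le (fun r => (r, L.C r (L.S t.1 t.2.1))) (fun a b h => by
    simp only [Prod.mk.injEq] at h; exact h.1) X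
  have i5 := card_inj_le (fun r => (t.1, L.C r (L.S t.1 t.2.1))) (fun a b h => by
    simp only [Prod.mk.injEq] at h; exact L.C_inj _ h.2) X
  have i6 := card_inj_le (fun r => (L.R (L.C r (L.S t.1 t.2.1)) t.2.2, L.C r (L.S t.1 t.2.1)))
    (fun a b h => by simp only [Prod.mk.injEq] at h; exact L.C_inj _ h.2) X
  have i7 := card_inj_le (fun r => (L.R (L.C r (L.S t.1 t.2.1)) t.2.2, L.C t.1 t.2.2))
    (fun a b h => by simp only [Prod.mk.injEq] at h; exact L.C_inj _ (L.R_inj _ h.1)) X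
  have hge := hg.2.2
  have := hc.trans ((Finset.card_union_le _ _).trans (add_le_add i0 ((Finset.card_union_le _ _).trans
    (add_le_add i1 ((Finset.card_union_le _ _).trans (add_le_add i2 ((Finset.card_union_le _ _).trans
    (add_le_add i3 ((Finset.card_union_le _ _).trans (add_le_add i4 ((Finset.card_union_le _ _).trans
    (add_le_add i5 ((Finset.card_union_le _ _).trans (add_le_add i6 i7))))))))))))))
  omega

theorem bd_virtual {α : Type} (R C y f CR Ry R' e Cy C' h Rz : α) :
    Bd ({(R, C, f)} + {(R, CR, y)} + {(Ry, C, y)} + ({(R', C, e)} + {(R', Cy, y)} + {(Ry, Cy, e)} +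
      {(R', C', f)} + {(R, C', h)} + {(Rz, C', y)} + {(Rz, CR, h)}))
      ({(R, C, y)} + ({(R', Cy, e)} + {(Ry, C, e)} + {(Ry, Cy, y)} + {(R, CR, h)} + {(Rz, C', h)} +
      {(Rz, CR, y)} + {(R, C', f)} + {(R', C', y)} + {(R', C, f)})) := by
  refine ⟨?_, ?_, ?_⟩ <;>
    (simp only [Multiset.map_add, Multiset.map_singleton, prc, prs, pcs]; abel)

theorem VR {α : Type} [Fintype α] [DecidableEq α] {L : LS α} {F : Finset (α × α)}
    {pr pc ps : α → Bool} (hI : Inv L F pr pc ps) (t : α × α × α) (hg : Good L F pr t)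
    (X : Finset (α × α)) (hX : X.card ≤ 68) :
    ∃ I : Multiset (α × α), I.Nodup ∧ I.card = 7 ∧ (∀ p ∈ I, p ∉ X ∧ p ∉ F) ∧
      ∃ Add, Bd ((Multiset.map L.tr (Ts L t)) + I.map L.tr) ({t} + Add) := by
  obtain ⟨R, C, y⟩ := t
  obtain ⟨r, hr, h1, h2, h3, h4⟩ := exists_row L F pr _ hg X hX R (L.R C y)
    (L.R (L.C R y) (L.S R C))
  obtain ⟨hfy, hT, -⟩ := hg
  simp only [freeRows, Finset.mem_filter, Finset.mem_univ, true_and] at hr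
  obtain ⟨hpr, hF⟩ := hr
  have hf : ∃ f, f = L.S R C := ⟨_, rfl⟩
  obtain ⟨f, hf⟩ := hf
  obtain ⟨CR, hCR⟩ : ∃ f, f = L.C R y := ⟨_, rfl⟩
  obtain ⟨Ry, hRy⟩ : ∃ f, f = L.R C y := ⟨_, rfl⟩
  obtain ⟨Cy, hCy⟩ : ∃ f, f = L.C r y := ⟨_, rfl⟩
  obtain ⟨C', hC'⟩ : ∃ g, g = L.C r f := ⟨_, rfl⟩
  obtain ⟨Rz, hRz⟩ : ∃ g, g = L.R C' y := ⟨_, rfl⟩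
  simp only [ints, Ts, ← hf, ← hCR, ← hRy, ← hCy, ← hC', ← hRz, List.mem_cons,
    List.not_mem_nil, or_false, forall_eq_or_imp, forall_eq] at h2 h3 h4 hfy hT hpr hF ⊢
  have sCR : L.S R CR = y := by rw [hCR]; simp
  have sRy : L.S Ry C = y := by rw [hRy]; simp
  have sCy : L.S r Cy = y := by rw [hCy]; simp
  have sC' : L.S r C' = f := by rw [hC']; simp
  have sRz : L.S Rz C' = y := by rw [hRz]; simp
  have b1 : L.S Ry Cy = L.S r C := hI.b r C Ry Cy (by tauto) (by tauto) (by tauto) (by tauto)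
    (by rw [sCy, sRy]) hpr
  have hpz : pr R ≠ pr Rz := by
    have q1 := hI.a R C (by tauto)
    have q2 := hI.a R CR (by tauto)
    have q3 := hI.a Ry C (by tauto)
    have q5 := hI.a r C' (by tauto)
    have q6 := hI.a Rz C' (by tauto)
    rw [← hf] at q1
    rw [sCR] at q2
    rw [sRy] at q3
    rw [sC'] at q5
    rw [sRz] at q6
    revert hpr q1 q2 q3 q5 q6
    cases pr R <;> cases pr Rz <;> cases pr r <;> cases pr Ry <;> cases pc C <;> cases pc C' <;>
      cases pc CR <;> cases ps y <;> cases ps f <;> simp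
  have b2 : L.S Rz CR = L.S R C' := hI.b R C' Rz CR (by tauto) (by tauto) (by tauto) (by tauto)
    (by rw [sCR, sRz]) hpz
  have nC : C ≠ Cy := by rintro rfl; apply h2; rw [hRy, ← sCy]; simp
  have nC' : C ≠ C' := by rintro rfl; apply h1; rw [← L.RS R C, ← hf, ← sC']; simp
  have nCR : C ≠ CR := by rintro rfl; apply hfy; rw [hf, sCR]
  have nyC' : Cy ≠ C' := by rintro rfl; apply hfy; rw [← sC', sCy]
  have nC'R : C' ≠ CR := by rintro rfl; apply h3; rw [← sC']; simp
  have nRRy : R ≠ Ry := by rintro rfl; apply hfy; rw [hf, sRy]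
  have nRyz : Rz ≠ Ry := by
    intro e; rw [e] at sRz; apply nC'; rw [← L.CS Ry C, sRy, ← sRz]; simp
  have nzr : Rz ≠ r := by
    intro e; rw [e] at sRz; apply hfy; rw [← sC', sRz]
  have nzR : Rz ≠ R := by
    intro e; rw [e] at sRz; apply nC'R; rw [hCR, ← sRz]; simp
  have nyR : Cy ≠ CR := by
    intro e; apply h1; rw [← L.RS r Cy, sCy, e, hCR]; simp
  refine ⟨((({(r, C)} + {(r, Cy)} + {(Ry, Cy)} + {(r, C')} + {(R, C')} + {(Rz, C')} + {(Rz, CR)} :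
    Multiset (α × α)))), ?_, by simp, ?_, ?_⟩
  rotate_left 2
  · have := bd_virtual R C y f CR Ry r (L.S r C) Cy C' (L.S R C') Rz
    refine ⟨_, Bd.trans (N := _) ?_ this⟩
    simp only [LS.tr, Multiset.map_add, Multiset.map_singleton, sCR, sRy, sCy, sC', sRz, b1, b2,
      Multiset.map_coe, List.map_cons, List.map_nil, ← hf]
    exact Bd.refl _
  · have : (({(r, C)} + {(r, Cy)} + {(Ry, Cy)} + {(r, C')} + {(R, C')} + {(Rz, C')} + {(Rz, CR)} :
      Multiset (α × α))) = ([(r, C), (r, Cy), (Ry, Cy), (r, C'), (R, C'), (Rz, C'), (Rz, CR)] : List _) := rfl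
    rw [this, Multiset.coe_nodup]
    simp only [List.nodup_cons, List.mem_cons, Prod.mk.injEq, List.not_mem_nil, List.nodup_nil]
    grind
  · intro p hp
    simp only [Multiset.mem_add, Multiset.mem_singleton] at hp
    rcases hp with (((((h | h) | h) | h) | h) | h) | h <;> rw [h] <;> tauto

theorem VRs {α : Type} [Fintype α] [DecidableEq α] {L : LS α} {F : Finset (α × α)}
    {pr pc ps : α → Bool} (hI : Inv L F pr pc ps) (V : List (α × α × α)) :
    ∀ (X : Finset (α × α)), (∀ t ∈ V, Good L F pr t) → X.card + 7 * V.length ≤ 75 →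
    ∃ I : Multiset (α × α), I.Nodup ∧ I.card = 7 * V.length ∧ (∀ p ∈ I, p ∉ X ∧ p ∉ F) ∧
      ∃ Add, Bd (Multiset.map L.tr (V.flatMap (Ts L)) + I.map L.tr) ((V : Multiset _) + Add) := by
  induction V with
  | nil =>
    intro X _ _
    exact ⟨0, by simp, by simp, by simp, 0, by simp [Bd]⟩
  | cons t V ih =>
    intro X hV hX
    simp only [List.length_cons] at hX
    obtain ⟨I, hI1, hI2, hI3, A, hA⟩ := VR hI t (hV t (by simp)) X (by omega)
    obtain ⟨J, hJ1, hJ2, hJ3, B, hB⟩ := ih (X ∪ I.toFinset) (fun t ht => hV t (by simp [ht])) (by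
      have := Finset.card_union_le X I.toFinset
      have h2 := Multiset.toFinset_card_le I
      omega)
    refine ⟨I + J, ?_, ?_, ?_, A + B, ?_⟩
    · rw [Multiset.nodup_add]
      refine ⟨hI1, hJ1, ?_⟩
      rw [Multiset.disjoint_left]
      intro p hp hp'
      have := (hJ3 p hp').1
      simp [hp] at this
    · simp [hI2, hJ2]; ring
    · intro p hp
      rcases Multiset.mem_add.1 hp with h | h
      · exact hI3 p h
      · have := hJ3 p h
        simp only [Finset.mem_union, not_or] at this
        exact ⟨this.1.1, this.2⟩
    · have := hA.add hB
      convert this using 1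
      · simp only [List.flatMap_cons, ← Multiset.coe_add, Multiset.map_add]
        abel
      · rw [← Multiset.cons_coe, ← Multiset.singleton_add]
        abel
end PLS

namespace PLS
open Finset

theorem count_mem {Ω β Z : Type} [Fintype Ω] [Fintype Z] [DecidableEq β] (f : Ω → β) (p : Ω → Z)
    (ψ : β → Z → Ω) (h : ∀ ω, ψ (f ω) (p ω) = ω) (B : Finset β) :
    (univ.filter fun ω => f ω ∈ B).card ≤ B.card * Fintype.card Z := by
  classical
  rw [← Finset.card_univ, ← Finset.card_product]
  apply Finset.card_le_card_of_injOn (fun ω => (f ω, p ω))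
  · intro ω hω
    simpa using hω
  · intro a _ b _ hab
    simp only [Prod.mk.injEq] at hab
    rw [← h a, ← h b, hab.1, hab.2]

theorem count_rec {Ω Z : Type} [Fintype Ω] [Fintype Z] (Q : Ω → Prop) [DecidablePred Q] (p : Ω → Z)
    (ψ : Z → Ω) (h : ∀ ω, Q ω → ψ (p ω) = ω) :
    (univ.filter Q).card ≤ Fintype.card Z := by
  classical
  rw [← Finset.card_univ]
  apply Finset.card_le_card_of_injOn p
  · intro ω hω
    simp
  · intro a ha b hb hab
    simp only [coe_filter, mem_univ, true_and, Set.mem_setOf_eq] at ha hb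
    rw [← h a ha, ← h b hb, hab]

theorem count_or {Ω : Type} [Fintype Ω] (P Q : Ω → Prop) [DecidablePred P] [DecidablePred Q]
    {a b : ℕ} (ha : (univ.filter P).card ≤ a) (hb : (univ.filter Q).card ≤ b) :
    (univ.filter fun ω => P ω ∨ Q ω).card ≤ a + b := by
  classical
  rw [Finset.filter_or]
  exact (Finset.card_union_le _ _).trans (add_le_add ha hb)

theorem count_mono {Ω : Type} [Fintype Ω] (P Q : Ω → Prop) [DecidablePred P] [DecidablePred Q]
    (h : ∀ ω, P ω → Q ω) {a : ℕ} (hb : (univ.filter Q).card ≤ a) :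
    (univ.filter P).card ≤ a :=
  (Finset.card_le_card (fun x hx => by
    simp only [mem_filter, mem_univ, true_and] at hx ⊢; exact h x hx)).trans hb

open Classical in
noncomputable def Bad {α : Type} [Fintype α] [DecidableEq α] (L : LS α) (F : Finset (α × α))
    (pr : α → Bool) : Finset (α × α × α) := univ.filter fun t => ¬ Good L F pr t

open Classical in
theorem int_count {α : Type} [Fintype α] [DecidableEq α] (L : LS α) (F : Finset (α × α)) :
    (univ.filter fun q : (α × α × α) × α => ∃ p ∈ ints L q.1 q.2, p ∈ F).card ≤
      7 * (F.card * Fintype.card (α × α)) := by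
  have i1 := count_mem (fun q : (α × α × α) × α => (q.2, q.1.2.1)) (fun q => (q.1.1, q.1.2.2))
    (fun b z => ((z.1, b.2, z.2), b.1)) (fun ω => rfl) F
  have i2 := count_mem (fun q : (α × α × α) × α => (q.2, L.C q.2 q.1.2.2)) (fun q => (q.1.1, q.1.2.1))
    (fun b z => ((z.1, z.2, L.S b.1 b.2), b.1)) (fun ω => by simp) F
  have i3 := count_mem (fun q : (α × α × α) × α => (L.R q.1.2.1 q.1.2.2, L.C q.2 q.1.2.2))
    (fun q => (q.1.1, q.1.2.2))
    (fun b z => ((z.1, L.C b.1 z.2, z.2), L.R b.2 z.2)) (fun ω => by simp) F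
  have i4 := count_mem (fun q : (α × α × α) × α => (q.2, L.C q.2 (L.S q.1.1 q.1.2.1)))
    (fun q => (q.1.1, q.1.2.2))
    (fun b z => ((z.1, L.C z.1 (L.S b.1 b.2), z.2), b.1)) (fun ω => by simp) F
  have i5 := count_mem (fun q : (α × α × α) × α => (q.1.1, L.C q.2 (L.S q.1.1 q.1.2.1)))
    (fun q => (q.1.2.1, q.1.2.2))
    (fun b z => ((b.1, z.1, z.2), L.R b.2 (L.S b.1 z.1))) (fun ω => by simp) F
  have i6 := count_mem (fun q : (α × α × α) × α =>
      (L.R (L.C q.2 (L.S q.1.1 q.1.2.1)) q.1.2.2, L.C q.2 (L.S q.1.1 q.1.2.1)))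
    (fun q => (q.1.1, q.1.2.1))
    (fun b z => ((z.1, z.2, L.S b.1 b.2), L.R b.2 (L.S z.1 z.2))) (fun ω => by simp) F
  have i7 := count_mem (fun q : (α × α × α) × α =>
      (L.R (L.C q.2 (L.S q.1.1 q.1.2.1)) q.1.2.2, L.C q.1.1 q.1.2.2))
    (fun q => (q.1.1, q.1.2.1))
    (fun b z => ((z.1, z.2, L.S z.1 b.2), L.R (L.C b.1 (L.S z.1 b.2)) (L.S z.1 z.2)))
    (fun ω => by simp) F
  refine (count_mono _ _ ?_ (count_or _ _ i1 (count_or _ _ i2 (count_or _ _ i3 (count_or _ _ i4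
    (count_or _ _ i5 (count_or _ _ i6 i7))))))).trans (le_of_eq (by ring))
  rintro ω ⟨p, hp, hpF⟩
  simp only [ints, List.mem_cons, List.not_mem_nil, or_false] at hp
  rcases hp with h | h | h | h | h | h | h <;> rw [h] at hpF <;> simp only [hpF, true_or, or_true]

open Classical in
theorem few_count {α : Type} [Fintype α] [DecidableEq α] (L : LS α) (F : Finset (α × α))
    (pr : α → Bool) (hn : 120000 ≤ Fintype.card α)
    (hpr : ∀ b, Fintype.card α ≤ 2 * (univ.filter fun i => pr i = b).card + 8) :
    7 * (univ.filter fun t => (freeRows L F pr t).card < 500).card ≤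
      100 * (F.card * Fintype.card α) := by
  set n := Fintype.card α with hnd
  set B := univ.filter fun t => (freeRows L F pr t).card < 500 with hB
  have hmul : B.card * (n * 49) ≤ 100 * (7 * (F.card * Fintype.card (α × α))) := by
    have h1 := int_count L F
    have h2 : ∀ t ∈ B, n * 49 ≤ 100 * (univ.filter fun r => ∃ p ∈ ints L t r, p ∈ F).card := by
      intro t ht
      simp only [hB, mem_filter, mem_univ, true_and] at ht
      have h3 : (univ.filter fun i => pr i = ! pr (L.R t.2.1 t.2.2)) ⊆ freeRows L F pr t ∪
          (univ.filter fun r => ∃ p ∈ ints L t r, p ∈ F) := by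
        intro r hr
        simp only [mem_filter, mem_univ, true_and] at hr
        simp only [mem_union, freeRows, mem_filter, mem_univ, true_and]
        by_cases h : ∃ p ∈ ints L t r, p ∈ F
        · exact Or.inr h
        · left
          refine ⟨by rw [hr]; simp, ?_⟩
          push Not at h
          exact h
      have h4 := (card_le_card h3).trans (card_union_le _ _)
      have h5 := hpr (! pr (L.R t.2.1 t.2.2))
      omega
    have h6 : ∑ t ∈ B, (univ.filter fun r => ∃ p ∈ ints L t r, p ∈ F).card ≤
        (univ.filter fun q : (α × α × α) × α => ∃ p ∈ ints L q.1 q.2, p ∈ F).card := by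
      rw [← Finset.card_sigma]
      apply Finset.card_le_card_of_injOn (fun x => (x.1, x.2))
      · intro x hx
        simp only [coe_sigma, Set.mem_sigma_iff] at hx
        simpa using hx.2
      · rintro ⟨a, b⟩ _ ⟨c, d⟩ _ h
        simp only [Prod.mk.injEq] at h
        rw [h.1, h.2]
    calc B.card * (n * 49) = ∑ t ∈ B, n * 49 := by simp
      _ ≤ ∑ t ∈ B, 100 * (univ.filter fun r => ∃ p ∈ ints L t r, p ∈ F).card := sum_le_sum h2
      _ = 100 * ∑ t ∈ B, (univ.filter fun r => ∃ p ∈ ints L t r, p ∈ F).card := by rw [mul_sum]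
      _ ≤ _ := Nat.mul_le_mul_left _ (h6.trans h1)
  rw [Fintype.card_prod, ← hnd] at hmul
  have hpos : 0 < 7 * n := by omega
  apply Nat.le_of_mul_le_mul_left _ hpos
  nlinarith [hmul]

theorem bad_count {α : Type} [Fintype α] [DecidableEq α] (L : LS α) (F : Finset (α × α))
    (pr : α → Bool) (hn : 120000 ≤ Fintype.card α)
    (hpr : ∀ b, Fintype.card α ≤ 2 * (univ.filter fun i => pr i = b).card + 8) :
    7 * (Bad L F pr).card ≤ 7 * (Fintype.card α * Fintype.card α) +
      121 * (F.card * Fintype.card α) := by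
  classical
  have i0 := count_rec (fun t : α × α × α => L.S t.1 t.2.1 = t.2.2) (fun t => (t.1, t.2.1))
    (fun z => (z.1, z.2, L.S z.1 z.2)) (fun ω h => by simp [h])
  have i1 := count_mem (fun t : α × α × α => (t.1, t.2.1)) (fun t => t.2.2)
    (fun b z => (b.1, b.2, z)) (fun ω => rfl) F
  have i2 := count_mem (fun t : α × α × α => (t.1, L.C t.1 t.2.2)) (fun t => t.2.1)
    (fun b z => (b.1, z, L.S b.1 b.2)) (fun ω => by simp) F
  have i3 := count_mem (fun t : α × α × α => (L.R t.2.1 t.2.2, t.2.1)) (fun t => t.1)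
    (fun b z => (z, b.2, L.S b.1 b.2)) (fun ω => by simp) F
  have i4 := few_count L F pr hn hpr
  have := count_mono (fun t => ¬ Good L F pr t) _ ?_ (count_or _ _ i0 (count_or _ _ i1
    (count_or _ _ i2 (count_or _ _ i3 (le_refl
      (univ.filter fun t => (freeRows L F pr t).card < 500).card)))))
  · rw [Fintype.card_prod] at this
    have h2 : (Bad L F pr).card = (univ.filter fun t => ¬ Good L F pr t).card := by
      unfold Bad; congr
    rw [h2]
    nlinarith [this]
  · intro t ht
    by_contra hc
    push Not at hc
    apply ht
    refine ⟨hc.1, ?_, hc.2.2.2.2⟩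
    intro p hp
    simp only [Ts, List.mem_cons, List.not_mem_nil, or_false] at hp
    rcases hp with h | h | h <;> rw [h] <;> tauto
end PLS

namespace PLS
open Finset

theorem bd_hex {α : Type} (r c s a c' r' z w u d g x r1 xs v ys xc r2 y yc k t q : α) :
    Bd (({(r, c, a)} + {(r, c', s)} + {(r', c, s)} + {(r1, c', u)} + {(r', d, v)} + {(r2, g, a)} +
        {(r, x, u)} + {(r, g, y)} + {(r1, xs, s)} + {(ys, d, s)} + {(xc, c, v)} + {(r2, c, yc)}) +
        ({(z, k, u)} + {(z, t, v)} + {(z, g, q)}) +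
        ({(z, x, y)} + {(ys, xs, w)} + {(xc, t, yc)} + {(r1, k, w)} + {(z, d, w)} + {(r2, t, q)}))
      ({(r, c, s)} + ({(r, c', u)} + {(r1, c', s)} + {(r', d, s)} + {(r', c, v)} + {(r2, c, a)} +
        {(r, g, a)} + {(r, x, y)} + {(ys, xs, s)} + {(xc, c, yc)} + {(z, x, u)} + {(z, g, y)} +
        {(r1, xs, w)} + {(ys, d, w)} + {(xc, t, v)} + {(r2, t, yc)} + {(r1, k, u)} + {(z, d, v)} +
        {(r2, g, q)} + {(z, k, w)} + {(z, t, q)})) := by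
  refine ⟨?_, ?_, ?_⟩ <;>
    (simp only [Multiset.map_add, Multiset.map_singleton, prc, prs, pcs]; abel)

end PLS

namespace PLS
open Finset

set_option maxHeartbeats 4000000 in
theorem nodup21 {α : Type} (L : LS α)
    (r c s a c' r' z w u d g x r1 xs v ys xc r2 y yc k t q : α)
    (p12 p13 p22 p23 p32 p33 p52 p53 p62 p63 p82 p83 : α)
    (e1 : L.S r c = a) (e2 : L.S r c' = s) (e3 : L.S r' c = s) (e4 : L.S r x = u)
    (e5 : L.S r1 c' = u) (e6 : L.S r1 xs = s) (e7 : L.S r' d = v) (e8 : L.S ys d = s)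
    (e9 : L.S xc c = v) (e10 : L.S r2 g = a) (e11 : L.S r g = y) (e12 : L.S r2 c = yc)
    (e13 : L.S z k = u) (e14 : L.S z t = v) (e15 : L.S z g = q)
    (f12 : L.S z p12 = y) (f13 : L.S p13 x = y)
    (f22 : L.S ys p22 = w) (f23 : L.S p23 xs = w)
    (f32 : L.S xc p32 = yc) (f33 : L.S p33 t = yc)
    (f52 : L.S r1 p52 = w) (f53 : L.S p53 k = w)
    (f62 : L.S z p62 = w) (f63 : L.S p63 d = w)
    (f82 : L.S r2 p82 = q) (f83 : L.S p83 t = q)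
    (g1 : L.S z x ≠ y) (g2 : L.S ys xs ≠ w) (g3 : L.S xc t ≠ yc) (g5 : L.S r1 k ≠ w)
    (g6 : L.S z d ≠ w) (g8 : L.S r2 t ≠ q)
    (zr : z ≠ r) (zr' : z ≠ r') (ws : w ≠ s) (tc : t ≠ c)
    (h1 : u ≠ v) (h2 : u ≠ q) (h3 : u ≠ y) (h4 : L.S z d ≠ u) (h5 : u ≠ w) (h6 : v ≠ q) (h7 : x ≠ t)
    (h8 : v ≠ y) (h9 : v ≠ w) (h10 : g ≠ x) (h11 : d ≠ g) (h12 : q ≠ w) (h13 : x ≠ d)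
    (h14 : L.S z x ≠ w) (h15 : L.S z d ≠ y) (h16 : y ≠ w) (h17 : z ≠ ys) (h18 : z ≠ xc)
    (h19 : z ≠ r1) (h20 : z ≠ r2) (h21 : L.S z xs ≠ w) (h22 : v ≠ yc) (h23 : L.S ys x ≠ y)
    (h24 : L.S xc x ≠ y) (h25 : xs ≠ t) (h26 : L.S ys xs ≠ yc) (h27 : ys ≠ r1) (h28 : xs ≠ k)
    (h29 : xs ≠ d) (h30 : ys ≠ r2) (h31 : L.S ys t ≠ w) (h32 : w ≠ yc) (h33 : L.S ys k ≠ w)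
    (h34 : xc ≠ r1) (h35 : xc ≠ r2) (h36 : L.S xc t ≠ q) (h37 : q ≠ yc) (h38 : r1 ≠ r2)
    (h39 : L.S r1 d ≠ w) :
    [(z, k), (z, t), (z, g), (z, x), (z, p12), (p13, x), (ys, xs), (ys, p22), (p23, xs),
      (xc, t), (xc, p32), (p33, t), (r1, k), (r1, p52), (p53, k), (z, d), (z, p62), (p63, d),
      (r2, t), (r2, p82), (p83, t)].Nodup := by
  have ri : ∀ i j j', L.S i j = L.S i j' → j = j' := fun i j j' h => by
    rw [← L.CS i j, h, L.CS]
  have ci : ∀ i i' j, L.S i j = L.S i' j → i = i' := fun i i' j h => by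
    rw [← L.RS i j, h, L.RS]
  have kx : k ≠ x := fun h => zr (ci _ _ k (by rw [e13, h, e4]))
  have td : t ≠ d := fun h => zr' (ci _ _ t (by rw [e14, h, e7]))
  have qy : q ≠ y := fun h => zr (ci _ _ g (by rw [e15, h, e11]))
  simp only [List.nodup_cons, List.mem_cons, Prod.mk.injEq, List.not_mem_nil, List.nodup_nil,
    or_false, not_or, not_false_eq_true, and_true]
  refine ⟨⟨?_,?_,?_,?_,?_,?_,?_,?_,?_,?_,?_,?_,?_,?_,?_,?_,?_,?_,?_,?_⟩,
    ⟨?_,?_,?_,?_,?_,?_,?_,?_,?_,?_,?_,?_,?_,?_,?_,?_,?_,?_,?_⟩,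
    ⟨?_,?_,?_,?_,?_,?_,?_,?_,?_,?_,?_,?_,?_,?_,?_,?_,?_,?_⟩,
    ⟨?_,?_,?_,?_,?_,?_,?_,?_,?_,?_,?_,?_,?_,?_,?_,?_,?_⟩,
    ⟨?_,?_,?_,?_,?_,?_,?_,?_,?_,?_,?_,?_,?_,?_,?_,?_⟩,
    ⟨?_,?_,?_,?_,?_,?_,?_,?_,?_,?_,?_,?_,?_,?_,?_⟩,
    ⟨?_,?_,?_,?_,?_,?_,?_,?_,?_,?_,?_,?_,?_,?_⟩,
    ⟨?_,?_,?_,?_,?_,?_,?_,?_,?_,?_,?_,?_,?_⟩,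
    ⟨?_,?_,?_,?_,?_,?_,?_,?_,?_,?_,?_,?_⟩,
    ⟨?_,?_,?_,?_,?_,?_,?_,?_,?_,?_,?_⟩,
    ⟨?_,?_,?_,?_,?_,?_,?_,?_,?_,?_⟩,
    ⟨?_,?_,?_,?_,?_,?_,?_,?_,?_⟩,
    ⟨?_,?_,?_,?_,?_,?_,?_,?_⟩,
    ⟨?_,?_,?_,?_,?_,?_,?_⟩,
    ⟨?_,?_,?_,?_,?_,?_⟩,
    ⟨?_,?_,?_,?_,?_⟩,
    ⟨?_,?_,?_,?_⟩,
    ⟨?_,?_,?_⟩,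
    ⟨?_,?_⟩,
    ?_⟩ <;> rintro ⟨hh1, hh2⟩ <;> (try first | exact h17 hh1 | exact h18 hh1 | exact h19 hh1 | exact h20 hh1 | exact kx hh2 | exact td hh2 | grind only)
end PLS

namespace PLS
open Finset
set_option linter.unusedVariables false
set_option linter.unreachableTactic false

open Classical in
noncomputable def cnt {Ω : Type} [Fintype Ω] (Q : Ω → Prop) : ℕ := (univ.filter Q).card

theorem cnt_or {Ω : Type} [Fintype Ω] (P Q : Ω → Prop) {a b : ℕ} (ha : cnt P ≤ a) (hb : cnt Q ≤ b) :
    cnt (fun ω => P ω ∨ Q ω) ≤ a + b := by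
  classical
  have := count_or P Q (a := a) (b := b) (by unfold cnt at ha; convert ha) (by unfold cnt at hb; convert hb)
  unfold cnt
  convert this

theorem cnt_mem {Ω β Z : Type} [Fintype Ω] [Fintype Z] (B : Finset β) (f : Ω → β) (p : Ω → Z)
    (ψ : β → Z → Ω) (h : ∀ ω, ψ (f ω) (p ω) = ω) :
    cnt (fun ω => f ω ∈ B) ≤ B.card * Fintype.card Z := by
  classical
  have := count_mem f p ψ h B
  unfold cnt
  convert this

theorem cnt_rec {Ω Z : Type} [Fintype Ω] [Fintype Z] (Q : Ω → Prop) (p : Ω → Z)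
    (ψ : Z → Ω) (h : ∀ ω, Q ω → ψ (p ω) = ω) : cnt Q ≤ Fintype.card Z := by
  classical
  have := count_rec Q p ψ h
  unfold cnt
  convert this

theorem cnt_mono {Ω : Type} [Fintype Ω] (P Q : Ω → Prop)
    (h : ∀ ω, P ω → Q ω) {a : ℕ} (hb : cnt Q ≤ a) : cnt P ≤ a := by
  classical
  have := count_mono P Q h (a := a) (by unfold cnt at hb; convert hb)
  unfold cnt
  convert this

abbrev Q5 (α : Type) := α × α × α × α × α
abbrev Q4 (α : Type) := α × α × α × α

/-- view a five-argument predicate as a predicate on tuples -/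
def on5 {α : Type} (Q : α → α → α → α → α → Prop) (ω : Q5 α) : Prop :=
  Q ω.1 ω.2.1 ω.2.2.1 ω.2.2.2.1 ω.2.2.2.2

theorem on5_or {α : Type} [Fintype α] (P Q : α → α → α → α → α → Prop) {a b : ℕ}
    (ha : cnt (on5 P) ≤ a) (hb : cnt (on5 Q) ≤ b) :
    cnt (on5 fun z w u d g => P z w u d g ∨ Q z w u d g) ≤ a + b := cnt_or _ _ ha hb

theorem on5_mem {α β Z : Type} [Fintype α] [Fintype Z] (B : Finset β) (f : α → α → α → α → α → β)
    (p : α → α → α → α → α → Z) (ψ : β → Z → Q5 α)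
    (h : ∀ z w u d g, ψ (f z w u d g) (p z w u d g) = (z, w, u, d, g)) :
    cnt (on5 fun z w u d g => f z w u d g ∈ B) ≤ B.card * Fintype.card Z :=
  cnt_mem B (fun ω : Q5 α => f ω.1 ω.2.1 ω.2.2.1 ω.2.2.2.1 ω.2.2.2.2)
    (fun ω : Q5 α => p ω.1 ω.2.1 ω.2.2.1 ω.2.2.2.1 ω.2.2.2.2) ψ (fun ω => h _ _ _ _ _)

theorem rec_z {α : Type} [Fintype α] (Q : α → α → α → α → α → Prop) (f : α → α → α → α → α)
    (h : ∀ z w u d g, Q z w u d g → f w u d g = z) : cnt (on5 Q) ≤ Fintype.card (Q4 α) :=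
  cnt_rec _ (fun ω => (ω.2.1, ω.2.2.1, ω.2.2.2.1, ω.2.2.2.2)) (fun x => (f x.1 x.2.1 x.2.2.1 x.2.2.2, x.1, x.2.1, x.2.2.1, x.2.2.2)) (by
    rintro ⟨z, w, u, d, g⟩ hq
    have := h z w u d g hq
    simp [this])

theorem rec_w {α : Type} [Fintype α] (Q : α → α → α → α → α → Prop) (f : α → α → α → α → α)
    (h : ∀ z w u d g, Q z w u d g → f z u d g = w) : cnt (on5 Q) ≤ Fintype.card (Q4 α) :=
  cnt_rec _ (fun ω => (ω.1, ω.2.2.1, ω.2.2.2.1, ω.2.2.2.2)) (fun x => (x.1, f x.1 x.2.1 x.2.2.1 x.2.2.2, x.2.1, x.2.2.1, x.2.2.2)) (by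
    rintro ⟨z, w, u, d, g⟩ hq
    have := h z w u d g hq
    simp [this])

theorem rec_u {α : Type} [Fintype α] (Q : α → α → α → α → α → Prop) (f : α → α → α → α → α)
    (h : ∀ z w u d g, Q z w u d g → f z w d g = u) : cnt (on5 Q) ≤ Fintype.card (Q4 α) :=
  cnt_rec _ (fun ω => (ω.1, ω.2.1, ω.2.2.2.1, ω.2.2.2.2)) (fun x => (x.1, x.2.1, f x.1 x.2.1 x.2.2.1 x.2.2.2, x.2.2.1, x.2.2.2)) (by
    rintro ⟨z, w, u, d, g⟩ hq
    have := h z w u d g hq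
    simp [this])

theorem rec_d {α : Type} [Fintype α] (Q : α → α → α → α → α → Prop) (f : α → α → α → α → α)
    (h : ∀ z w u d g, Q z w u d g → f z w u g = d) : cnt (on5 Q) ≤ Fintype.card (Q4 α) :=
  cnt_rec _ (fun ω => (ω.1, ω.2.1, ω.2.2.1, ω.2.2.2.2)) (fun x => (x.1, x.2.1, x.2.2.1, f x.1 x.2.1 x.2.2.1 x.2.2.2, x.2.2.2)) (by
    rintro ⟨z, w, u, d, g⟩ hq
    have := h z w u d g hq
    simp [this])

theorem rec_g {α : Type} [Fintype α] (Q : α → α → α → α → α → Prop) (f : α → α → α → α → α)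
    (h : ∀ z w u d g, Q z w u d g → f z w u d = g) : cnt (on5 Q) ≤ Fintype.card (Q4 α) :=
  cnt_rec _ (fun ω => (ω.1, ω.2.1, ω.2.2.1, ω.2.2.2.1)) (fun x => (x.1, x.2.1, x.2.2.1, x.2.2.2, f x.1 x.2.1 x.2.2.1 x.2.2.2)) (by
    rintro ⟨z, w, u, d, g⟩ hq
    have := h z w u d g hq
    simp [this])

def Coinc {α : Type} (L : LS α) (r c s a c' r' : α) (z w u d g : α) : Prop :=
  u = (L.S r' d) ∨
  u = (L.S z g) ∨
  u = (L.S r g) ∨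
  L.S z d = u ∨
  u = w ∨
  (L.S r' d) = (L.S z g) ∨
  (L.C r u) = (L.C z (L.S r' d)) ∨
  (L.S r' d) = (L.S r g) ∨
  (L.S r' d) = w ∨
  g = (L.C r u) ∨
  d = g ∨
  (L.S z g) = w ∨
  (L.C r u) = d ∨
  L.S z (L.C r u) = w ∨
  L.S z d = (L.S r g) ∨
  (L.S r g) = w ∨
  z = (L.R d s) ∨
  z = (L.R c (L.S r' d)) ∨
  z = (L.R c' u) ∨
  z = (L.R g a) ∨
  L.S z (L.C (L.R c' u) s) = w ∨
  (L.S r' d) = (L.S (L.R g a) c) ∨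
  L.S (L.R d s) (L.C r u) = (L.S r g) ∨
  L.S (L.R c (L.S r' d)) (L.C r u) = (L.S r g) ∨
  (L.C (L.R c' u) s) = (L.C z (L.S r' d)) ∨
  L.S (L.R d s) (L.C (L.R c' u) s) = (L.S (L.R g a) c) ∨
  (L.R d s) = (L.R c' u) ∨
  (L.C (L.R c' u) s) = (L.C z u) ∨
  (L.C (L.R c' u) s) = d ∨
  (L.R d s) = (L.R g a) ∨
  L.S (L.R d s) (L.C z (L.S r' d)) = w ∨
  w = (L.S (L.R g a) c) ∨
  L.S (L.R d s) (L.C z u) = w ∨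
  (L.R c (L.S r' d)) = (L.R c' u) ∨
  (L.R c (L.S r' d)) = (L.R g a) ∨
  L.S (L.R c (L.S r' d)) (L.C z (L.S r' d)) = (L.S z g) ∨
  (L.S z g) = (L.S (L.R g a) c) ∨
  (L.R c' u) = (L.R g a) ∨
  L.S (L.R c' u) d = w

def RingBad {α : Type} (L : LS α) (r c s a c' r' : α) (Prot : Finset (α × α)) (z w u d g : α) : Prop :=
  ((L.R c' u), c') ∈ Prot ∨
  (r', d) ∈ Prot ∨
  ((L.R g a), g) ∈ Prot ∨
  (r, (L.C r u)) ∈ Prot ∨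
  (r, g) ∈ Prot ∨
  ((L.R c' u), (L.C (L.R c' u) s)) ∈ Prot ∨
  ((L.R d s), d) ∈ Prot ∨
  ((L.R c (L.S r' d)), c) ∈ Prot ∨
  ((L.R g a), c) ∈ Prot

def RealBad {α : Type} (L : LS α) (r c s a c' r' : α) (F : Finset (α × α)) (z w u d g : α) : Prop :=
  (z, (L.C z u)) ∈ F ∨
  (z, (L.C z (L.S r' d))) ∈ F ∨
  (z, g) ∈ F

def VBad {α : Type} (L : LS α) (r c s a c' r' : α) (B : Finset (α × α × α)) (z w u d g : α) : Prop :=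
  (z, (L.C r u), (L.S r g)) ∈ B ∨
  ((L.R d s), (L.C (L.R c' u) s), w) ∈ B ∨
  ((L.R c (L.S r' d)), (L.C z (L.S r' d)), (L.S (L.R g a) c)) ∈ B ∨
  ((L.R c' u), (L.C z u), w) ∈ B ∨
  (z, d, w) ∈ B ∨
  ((L.R g a), (L.C z (L.S r' d)), (L.S z g)) ∈ B

theorem coinc_count {α : Type} [Fintype α] (L : LS α) (r c s a c' r' : α) :
    cnt (on5 (Coinc L r c s a c' r')) ≤ 39 * Fintype.card (Q4 α) := by
  have i1 := rec_u (α := α) (fun z w u d g => u = (L.S r' d)) (fun _ _ d _ => (L.S r' d))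
    (fun z w u d g h => by first | exact h | exact h.symm | (rw [h]; simp) | (rw [← h]; simp) | rw [h] | rw [← h])
  have i2 := rec_u (α := α) (fun z w u d g => u = (L.S z g)) (fun z _ _ g => (L.S z g))
    (fun z w u d g h => by first | exact h | exact h.symm | (rw [h]; simp) | (rw [← h]; simp) | rw [h] | rw [← h])
  have i3 := rec_u (α := α) (fun z w u d g => u = (L.S r g)) (fun _ _ _ g => (L.S r g))
    (fun z w u d g h => by first | exact h | exact h.symm | (rw [h]; simp) | (rw [← h]; simp) | rw [h] | rw [← h])
  have i4 := rec_u (α := α) (fun z w u d g => L.S z d = u) (fun z _ d _ => L.S z d)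
    (fun z w u d g h => by first | exact h | exact h.symm | (rw [h]; simp) | (rw [← h]; simp) | rw [h] | rw [← h])
  have i5 := rec_u (α := α) (fun z w u d g => u = w) (fun _ w _ _ => w)
    (fun z w u d g h => by first | exact h | exact h.symm | (rw [h]; simp) | (rw [← h]; simp) | rw [h] | rw [← h])
  have i6 := rec_d (α := α) (fun z w u d g => (L.S r' d) = (L.S z g)) (fun z _ _ g => L.C r' (L.S z g))
    (fun z w u d g h => by first | exact h | exact h.symm | (rw [h]; simp) | (rw [← h]; simp) | rw [h] | rw [← h])
  have i7 := rec_u (α := α) (fun z w u d g => (L.C r u) = (L.C z (L.S r' d))) (fun z _ d _ => L.S r (L.C z (L.S r' d)))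
    (fun z w u d g h => by first | exact h | exact h.symm | (rw [h]; simp) | (rw [← h]; simp) | rw [h] | rw [← h])
  have i8 := rec_d (α := α) (fun z w u d g => (L.S r' d) = (L.S r g)) (fun _ _ _ g => L.C r' (L.S r g))
    (fun z w u d g h => by first | exact h | exact h.symm | (rw [h]; simp) | (rw [← h]; simp) | rw [h] | rw [← h])
  have i9 := rec_w (α := α) (fun z w u d g => (L.S r' d) = w) (fun _ _ d _ => (L.S r' d))
    (fun z w u d g h => by first | exact h | exact h.symm | (rw [h]; simp) | (rw [← h]; simp) | rw [h] | rw [← h])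
  have i10 := rec_g (α := α) (fun z w u d g => g = (L.C r u)) (fun _ _ u _ => (L.C r u))
    (fun z w u d g h => by first | exact h | exact h.symm | (rw [h]; simp) | (rw [← h]; simp) | rw [h] | rw [← h])
  have i11 := rec_d (α := α) (fun z w u d g => d = g) (fun _ _ _ g => g)
    (fun z w u d g h => by first | exact h | exact h.symm | (rw [h]; simp) | (rw [← h]; simp) | rw [h] | rw [← h])
  have i12 := rec_w (α := α) (fun z w u d g => (L.S z g) = w) (fun z _ _ g => (L.S z g))
    (fun z w u d g h => by first | exact h | exact h.symm | (rw [h]; simp) | (rw [← h]; simp) | rw [h] | rw [← h])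
  have i13 := rec_d (α := α) (fun z w u d g => (L.C r u) = d) (fun _ _ u _ => (L.C r u))
    (fun z w u d g h => by first | exact h | exact h.symm | (rw [h]; simp) | (rw [← h]; simp) | rw [h] | rw [← h])
  have i14 := rec_w (α := α) (fun z w u d g => L.S z (L.C r u) = w) (fun z u _ _ => L.S z (L.C r u))
    (fun z w u d g h => by first | exact h | exact h.symm | (rw [h]; simp) | (rw [← h]; simp) | rw [h] | rw [← h])
  have i15 := rec_d (α := α) (fun z w u d g => L.S z d = (L.S r g)) (fun z _ _ g => L.C z (L.S r g))
    (fun z w u d g h => by first | exact h | exact h.symm | (rw [h]; simp) | (rw [← h]; simp) | rw [h] | rw [← h])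
  have i16 := rec_w (α := α) (fun z w u d g => (L.S r g) = w) (fun _ _ _ g => (L.S r g))
    (fun z w u d g h => by first | exact h | exact h.symm | (rw [h]; simp) | (rw [← h]; simp) | rw [h] | rw [← h])
  have i17 := rec_z (α := α) (fun z w u d g => z = (L.R d s)) (fun _ _ d _ => (L.R d s))
    (fun z w u d g h => by first | exact h | exact h.symm | (rw [h]; simp) | (rw [← h]; simp) | rw [h] | rw [← h])
  have i18 := rec_z (α := α) (fun z w u d g => z = (L.R c (L.S r' d))) (fun _ _ d _ => (L.R c (L.S r' d)))
    (fun z w u d g h => by first | exact h | exact h.symm | (rw [h]; simp) | (rw [← h]; simp) | rw [h] | rw [← h])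
  have i19 := rec_z (α := α) (fun z w u d g => z = (L.R c' u)) (fun _ u _ _ => (L.R c' u))
    (fun z w u d g h => by first | exact h | exact h.symm | (rw [h]; simp) | (rw [← h]; simp) | rw [h] | rw [← h])
  have i20 := rec_z (α := α) (fun z w u d g => z = (L.R g a)) (fun _ _ _ g => (L.R g a))
    (fun z w u d g h => by first | exact h | exact h.symm | (rw [h]; simp) | (rw [← h]; simp) | rw [h] | rw [← h])
  have i21 := rec_w (α := α) (fun z w u d g => L.S z (L.C (L.R c' u) s) = w) (fun z u _ _ => L.S z (L.C (L.R c' u) s))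
    (fun z w u d g h => by first | exact h | exact h.symm | (rw [h]; simp) | (rw [← h]; simp) | rw [h] | rw [← h])
  have i22 := rec_d (α := α) (fun z w u d g => (L.S r' d) = (L.S (L.R g a) c)) (fun _ _ _ g => L.C r' (L.S (L.R g a) c))
    (fun z w u d g h => by first | exact h | exact h.symm | (rw [h]; simp) | (rw [← h]; simp) | rw [h] | rw [← h])
  have i23 := rec_g (α := α) (fun z w u d g => L.S (L.R d s) (L.C r u) = (L.S r g)) (fun _ _ u d => L.C r (L.S (L.R d s) (L.C r u)))
    (fun z w u d g h => by first | exact h | exact h.symm | (rw [h]; simp) | (rw [← h]; simp) | rw [h] | rw [← h])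
  have i24 := rec_g (α := α) (fun z w u d g => L.S (L.R c (L.S r' d)) (L.C r u) = (L.S r g)) (fun _ _ u d => L.C r (L.S (L.R c (L.S r' d)) (L.C r u)))
    (fun z w u d g h => by first | exact h | exact h.symm | (rw [h]; simp) | (rw [← h]; simp) | rw [h] | rw [← h])
  have i25 := rec_d (α := α) (fun z w u d g => (L.C (L.R c' u) s) = (L.C z (L.S r' d))) (fun z _ u _ => L.C r' (L.S z (L.C (L.R c' u) s)))
    (fun z w u d g h => by first | exact h | exact h.symm | (rw [h]; simp) | (rw [← h]; simp) | rw [h] | rw [← h])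
  have i26 := rec_g (α := α) (fun z w u d g => L.S (L.R d s) (L.C (L.R c' u) s) = (L.S (L.R g a) c)) (fun _ _ u d => L.C (L.R c (L.S (L.R d s) (L.C (L.R c' u) s))) a)
    (fun z w u d g h => by first | exact h | exact h.symm | (rw [h]; simp) | (rw [← h]; simp) | rw [h] | rw [← h])
  have i27 := rec_u (α := α) (fun z w u d g => (L.R d s) = (L.R c' u)) (fun _ _ d _ => L.S (L.R d s) c')
    (fun z w u d g h => by first | exact h | exact h.symm | (rw [h]; simp) | (rw [← h]; simp) | rw [h] | rw [← h])
  have i28 := rec_z (α := α) (fun z w u d g => (L.C (L.R c' u) s) = (L.C z u)) (fun _ u _ _ => L.R (L.C (L.R c' u) s) u)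
    (fun z w u d g h => by first | exact h | exact h.symm | (rw [h]; simp) | (rw [← h]; simp) | rw [h] | rw [← h])
  have i29 := rec_d (α := α) (fun z w u d g => (L.C (L.R c' u) s) = d) (fun _ _ u _ => (L.C (L.R c' u) s))
    (fun z w u d g h => by first | exact h | exact h.symm | (rw [h]; simp) | (rw [← h]; simp) | rw [h] | rw [← h])
  have i30 := rec_g (α := α) (fun z w u d g => (L.R d s) = (L.R g a)) (fun _ _ _ d => L.C (L.R d s) a)
    (fun z w u d g h => by first | exact h | exact h.symm | (rw [h]; simp) | (rw [← h]; simp) | rw [h] | rw [← h])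
  have i31 := rec_w (α := α) (fun z w u d g => L.S (L.R d s) (L.C z (L.S r' d)) = w) (fun z _ d _ => L.S (L.R d s) (L.C z (L.S r' d)))
    (fun z w u d g h => by first | exact h | exact h.symm | (rw [h]; simp) | (rw [← h]; simp) | rw [h] | rw [← h])
  have i32 := rec_w (α := α) (fun z w u d g => w = (L.S (L.R g a) c)) (fun _ _ _ g => (L.S (L.R g a) c))
    (fun z w u d g h => by first | exact h | exact h.symm | (rw [h]; simp) | (rw [← h]; simp) | rw [h] | rw [← h])
  have i33 := rec_w (α := α) (fun z w u d g => L.S (L.R d s) (L.C z u) = w) (fun z u d _ => L.S (L.R d s) (L.C z u))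
    (fun z w u d g h => by first | exact h | exact h.symm | (rw [h]; simp) | (rw [← h]; simp) | rw [h] | rw [← h])
  have i34 := rec_u (α := α) (fun z w u d g => (L.R c (L.S r' d)) = (L.R c' u)) (fun _ _ d _ => L.S (L.R c (L.S r' d)) c')
    (fun z w u d g h => by first | exact h | exact h.symm | (rw [h]; simp) | (rw [← h]; simp) | rw [h] | rw [← h])
  have i35 := rec_g (α := α) (fun z w u d g => (L.R c (L.S r' d)) = (L.R g a)) (fun _ _ _ d => L.C (L.R c (L.S r' d)) a)
    (fun z w u d g h => by first | exact h | exact h.symm | (rw [h]; simp) | (rw [← h]; simp) | rw [h] | rw [← h])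
  have i36 := rec_g (α := α) (fun z w u d g => L.S (L.R c (L.S r' d)) (L.C z (L.S r' d)) = (L.S z g)) (fun z _ _ d => L.C z (L.S (L.R c (L.S r' d)) (L.C z (L.S r' d))))
    (fun z w u d g h => by first | exact h | exact h.symm | (rw [h]; simp) | (rw [← h]; simp) | rw [h] | rw [← h])
  have i37 := rec_z (α := α) (fun z w u d g => (L.S z g) = (L.S (L.R g a) c)) (fun _ _ _ g => L.R g (L.S (L.R g a) c))
    (fun z w u d g h => by first | exact h | exact h.symm | (rw [h]; simp) | (rw [← h]; simp) | rw [h] | rw [← h])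
  have i38 := rec_u (α := α) (fun z w u d g => (L.R c' u) = (L.R g a)) (fun _ _ _ g => L.S (L.R g a) c')
    (fun z w u d g h => by first | exact h | exact h.symm | (rw [h]; simp) | (rw [← h]; simp) | rw [h] | rw [← h])
  have i39 := rec_w (α := α) (fun z w u d g => L.S (L.R c' u) d = w) (fun _ u d _ => L.S (L.R c' u) d)
    (fun z w u d g h => by first | exact h | exact h.symm | (rw [h]; simp) | (rw [← h]; simp) | rw [h] | rw [← h])
  refine le_trans (on5_or _ _ i1 (on5_or _ _ i2 (on5_or _ _ i3 (on5_or _ _ i4 (on5_or _ _ i5 (on5_or _ _ i6 (on5_or _ _ i7 (on5_or _ _ i8 (on5_or _ _ i9 (on5_or _ _ i10 (on5_or _ _ i11 (on5_or _ _ i12 (on5_or _ _ i13 (on5_or _ _ i14 (on5_or _ _ i15 (on5_or _ _ i16 (on5_or _ _ i17 (on5_or _ _ i18 (on5_or _ _ i19 (on5_or _ _ i20 (on5_or _ _ i21 (on5_or _ _ i22 (on5_or _ _ i23 (on5_or _ _ i24 (on5_or _ _ i25 (on5_or _ _ i26 (on5_or _ _ i27 (on5_or _ _ i28 (on5_or _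 _ i29 (on5_or _ _ i30 (on5_or _ _ i31 (on5_or _ _ i32 (on5_or _ _ i33 (on5_or _ _ i34 (on5_or _ _ i35 (on5_or _ _ i36 (on5_or _ _ i37 (on5_or _ _ i38 i39)))))))))))))))))))))))))))))))))))))) (le_of_eq (by ring))

theorem ring_count {α : Type} [Fintype α] (L : LS α) (r c s a c' r' : α) [DecidableEq α] (Prot : Finset (α × α)) (e : ℕ)
    (hrow : ∀ i, (univ.filter fun j => (i, j) ∈ Prot).card ≤ e)
    (hcol : ∀ j, (univ.filter fun i => (i, j) ∈ Prot).card ≤ e)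
    (hsym : ∀ s, (univ.filter fun j => (L.R j s, j) ∈ Prot).card ≤ e) :
    cnt (on5 (RingBad L r c s a c' r' Prot)) ≤ 9 * (e * Fintype.card (Q4 α)) := by
  have key : ∀ (B : Finset α) (Q : α → α → α → α → α → Prop) (f : α → α → α → α → α → α)
      (p : α → α → α → α → α → Q4 α) (ψ : α → Q4 α → Q5 α), B.card ≤ e →
      (∀ z w u d g, Q z w u d g → f z w u d g ∈ B) →
      (∀ z w u d g, ψ (f z w u d g) (p z w u d g) = (z, w, u, d, g)) →
      cnt (on5 Q) ≤ e * Fintype.card (Q4 α) := by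
    intro B Q f p ψ hB hQ h
    exact (cnt_mono _ _ (fun ω h => hQ _ _ _ _ _ h) (on5_mem B f p ψ h)).trans
      (Nat.mul_le_mul_right _ hB)
  have i1 := key _ (fun z w u d g => ((L.R c' u), c') ∈ Prot) (fun z w u d g => (L.R c' u))
    (fun z w u d g => (z, w, d, g)) (fun b x => (x.1, x.2.1, L.S b c', x.2.2.1, x.2.2.2)) (hcol c')
    (fun z w u d g h => by simpa using h) (fun z w u d g => by simp)
  have i2 := key _ (fun z w u d g => (r', d) ∈ Prot) (fun z w u d g => d)
    (fun z w u d g => (z, w, u, g)) (fun b x => (x.1, x.2.1, x.2.2.1, b, x.2.2.2)) (hrow r')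
    (fun z w u d g h => by simpa using h) (fun z w u d g => by simp)
  have i3 := key _ (fun z w u d g => ((L.R g a), g) ∈ Prot) (fun z w u d g => g)
    (fun z w u d g => (z, w, u, d)) (fun b x => (x.1, x.2.1, x.2.2.1, x.2.2.2, b)) (hsym a)
    (fun z w u d g h => by simpa using h) (fun z w u d g => by simp)
  have i4 := key _ (fun z w u d g => (r, (L.C r u)) ∈ Prot) (fun z w u d g => (L.C r u))
    (fun z w u d g => (z, w, d, g)) (fun b x => (x.1, x.2.1, L.S r b, x.2.2.1, x.2.2.2)) (hrow r)
    (fun z w u d g h => by simpa using h) (fun z w u d g => by simp)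
  have i5 := key _ (fun z w u d g => (r, g) ∈ Prot) (fun z w u d g => g)
    (fun z w u d g => (z, w, u, d)) (fun b x => (x.1, x.2.1, x.2.2.1, x.2.2.2, b)) (hrow r)
    (fun z w u d g h => by simpa using h) (fun z w u d g => by simp)
  have i6 := key _ (fun z w u d g => ((L.R c' u), (L.C (L.R c' u) s)) ∈ Prot) (fun z w u d g => (L.C (L.R c' u) s))
    (fun z w u d g => (z, w, d, g)) (fun b x => (x.1, x.2.1, L.S (L.R b s) c', x.2.2.1, x.2.2.2)) (hsym s)
    (fun z w u d g h => by simpa using h) (fun z w u d g => by simp)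
  have i7 := key _ (fun z w u d g => ((L.R d s), d) ∈ Prot) (fun z w u d g => d)
    (fun z w u d g => (z, w, u, g)) (fun b x => (x.1, x.2.1, x.2.2.1, b, x.2.2.2)) (hsym s)
    (fun z w u d g h => by simpa using h) (fun z w u d g => by simp)
  have i8 := key _ (fun z w u d g => ((L.R c (L.S r' d)), c) ∈ Prot) (fun z w u d g => (L.R c (L.S r' d)))
    (fun z w u d g => (z, w, u, g)) (fun b x => (x.1, x.2.1, x.2.2.1, L.C r' (L.S b c), x.2.2.2)) (hcol c)
    (fun z w u d g h => by simpa using h) (fun z w u d g => by simp)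
  have i9 := key _ (fun z w u d g => ((L.R g a), c) ∈ Prot) (fun z w u d g => (L.R g a))
    (fun z w u d g => (z, w, u, d)) (fun b x => (x.1, x.2.1, x.2.2.1, x.2.2.2, L.C b a)) (hcol c)
    (fun z w u d g h => by simpa using h) (fun z w u d g => by simp)
  refine le_trans (on5_or _ _ i1 (on5_or _ _ i2 (on5_or _ _ i3 (on5_or _ _ i4 (on5_or _ _ i5 (on5_or _ _ i6 (on5_or _ _ i7 (on5_or _ _ i8 i9)))))))) (le_of_eq (by ring))

theorem real_count {α : Type} [Fintype α] (L : LS α) (r c s a c' r' : α) (F : Finset (α × α)) :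
    cnt (on5 (RealBad L r c s a c' r' F)) ≤ 3 * (F.card * Fintype.card (α × α × α)) := by
  have i1 := on5_mem F (fun z w u d g => (z, (L.C z u))) (fun z w u d g => (w, d, g))
    (fun b x => (b.1, x.1, L.S b.1 b.2, x.2.1, x.2.2)) (fun z w u d g => by simp)
  have i2 := on5_mem F (fun z w u d g => (z, (L.C z (L.S r' d)))) (fun z w u d g => (w, u, g))
    (fun b x => (b.1, x.1, x.2.1, L.C r' (L.S b.1 b.2), x.2.2)) (fun z w u d g => by simp)
  have i3 := on5_mem F (fun z w u d g => (z, g)) (fun z w u d g => (w, u, d))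
    (fun b x => (b.1, x.1, x.2.1, x.2.2, b.2)) (fun z w u d g => by simp)
  refine le_trans (on5_or _ _ i1 (on5_or _ _ i2 i3)) (le_of_eq (by ring))

theorem v_count {α : Type} [Fintype α] (L : LS α) (r c s a c' r' : α) (B : Finset (α × α × α)) :
    cnt (on5 (VBad L r c s a c' r' B)) ≤ 6 * (B.card * Fintype.card (α × α)) := by
  have i1 := on5_mem B (fun z w u d g => (z, (L.C r u), (L.S r g))) (fun z w u d g => (w, d))
    (fun b x => (b.1, x.1, L.S r b.2.1, x.2, L.C r b.2.2)) (fun z w u d g => by simp)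
  have i2 := on5_mem B (fun z w u d g => ((L.R d s), (L.C (L.R c' u) s), w)) (fun z w u d g => (z, g))
    (fun b x => (x.1, b.2.2, L.S (L.R b.2.1 s) c', L.C b.1 s, x.2)) (fun z w u d g => by simp)
  have i3 := on5_mem B (fun z w u d g => ((L.R c (L.S r' d)), (L.C z (L.S r' d)), (L.S (L.R g a) c))) (fun z w u d g => (w, u))
    (fun b x => (L.R b.2.1 (L.S b.1 c), x.1, x.2, L.C r' (L.S b.1 c), L.C (L.R c b.2.2) a)) (fun z w u d g => by simp)
  have i4 := on5_mem B (fun z w u d g => ((L.R c' u), (L.C z u), w)) (fun z w u d g => (d, g))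
    (fun b x => (L.R b.2.1 (L.S b.1 c'), b.2.2, L.S b.1 c', x.1, x.2)) (fun z w u d g => by simp)
  have i5 := on5_mem B (fun z w u d g => (z, d, w)) (fun z w u d g => (u, g))
    (fun b x => (b.1, b.2.2, x.1, b.2.1, x.2)) (fun z w u d g => by simp)
  have i6 := on5_mem B (fun z w u d g => ((L.R g a), (L.C z (L.S r' d)), (L.S z g))) (fun z w u d g => (w, u))
    (fun b x => (L.R (L.C b.1 a) b.2.2, x.1, x.2, L.C r' (L.S (L.R (L.C b.1 a) b.2.2) b.2.1), L.C b.1 a)) (fun z w u d g => by simp)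
  refine le_trans (on5_or _ _ i1 (on5_or _ _ i2 (on5_or _ _ i3 (on5_or _ _ i4 (on5_or _ _ i5 i6))))) (le_of_eq (by ring))

theorem exists_params {α : Type} [Fintype α] (L : LS α) (r c s a c' r' : α) [DecidableEq α] (Prot F : Finset (α × α))
    (pr : α → Bool) (e : ℕ)
    (hrow : ∀ i, (univ.filter fun j => (i, j) ∈ Prot).card ≤ e)
    (hcol : ∀ j, (univ.filter fun i => (i, j) ∈ Prot).card ≤ e)
    (hsym : ∀ s, (univ.filter fun j => (L.R j s, j) ∈ Prot).card ≤ e)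
    (hn : 120000 ≤ Fintype.card α)
    (hpr : ∀ b, Fintype.card α ≤ 2 * (univ.filter fun i => pr i = b).card + 8)
    (hnum : 747 * F.card + (63 * e + 315) * Fintype.card α < 7 * (Fintype.card α * Fintype.card α)) :
    ∃ z w u d g, ¬ RingBad L r c s a c' r' Prot z w u d g ∧ ¬ RealBad L r c s a c' r' F z w u d g ∧
      ¬ VBad L r c s a c' r' (Bad L F pr) z w u d g ∧ ¬ Coinc L r c s a c' r' z w u d g := by
  by_contra hcon
  have h1 := ring_count L r c s a c' r' Prot e hrow hcol hsym
  have h2 := real_count L r c s a c' r' F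
  have h3 := v_count L r c s a c' r' (Bad L F pr)
  have h4 := coinc_count L r c s a c' r'
  have h5 := cnt_mono (fun _ : Q5 α => True) _ (by
    rintro ⟨z, w, u, d, g⟩ -
    by_contra hc
    apply hcon
    simp only [not_or] at hc
    exact ⟨z, w, u, d, g, hc⟩) (cnt_or _ _ h1 (cnt_or _ _ h2 (cnt_or _ _ h3 h4)))
  have h6 : cnt (fun _ : Q5 α => True) = Fintype.card (Q5 α) := by
    unfold cnt; simp
  have h7 := bad_count L F pr hn hpr
  rw [h6] at h5
  simp only [Fintype.card_prod] at h5
  generalize Fintype.card α = n at *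
  generalize F.card = f at *
  generalize (Bad L F pr).card = b at *
  have hn3 : 0 < n * n * n := by positivity
  have h8 := Nat.mul_lt_mul_of_pos_right hnum hn3
  have h9 := Nat.mul_le_mul_right (6 * (n * n)) h7
  nlinarith [h5, h8, h9]

end PLS

namespace PLS
open Finset

set_option maxHeartbeats 4000000 in
theorem hex_trade {α : Type} [Fintype α] [DecidableEq α] {L : LS α} {F : Finset (α × α)}
    {pr pc ps : α → Bool} (hI : Inv L F pr pc ps) (Prot : Finset (α × α)) (r c s a c' r' : α)
    (e1 : L.S r c = a) (e2 : L.S r c' = s) (e3 : L.S r' c = s) (has : a ≠ s) (hPF : Prot ⊆ F)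
    (hforced : ∀ i j, (i = r ∨ i = r' ∨ j = c ∨ j = c' ∨ L.S i j = s ∨ L.S i j = a) → (i, j) ∈ F)
    (hb1 : (r, c) ∉ Prot) (hb2 : (r, c') ∉ Prot) (hb3 : (r', c) ∉ Prot) (z w u d g : α)
    (hring : ¬ RingBad L r c s a c' r' Prot z w u d g)
    (hreal : ¬ RealBad L r c s a c' r' F z w u d g)
    (hv : ¬ VBad L r c s a c' r' (Bad L F pr) z w u d g)
    (hco : ¬ Coinc L r c s a c' r' z w u d g) :
    ∃ W : Multiset (α × α), W.Nodup ∧ W.card = 75 ∧ (∀ p ∈ W, p ∉ Prot) ∧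
      ∃ Add, Bd (W.map L.tr) Add ∧ (r, c, s) ∈ Add := by
  unfold RingBad at hring
  unfold RealBad at hreal
  unfold VBad at hv
  unfold Coinc at hco
  obtain ⟨x, hx⟩ : ∃ x, x = L.C r u := ⟨_, rfl⟩
  obtain ⟨r1, hr1⟩ : ∃ x, x = L.R c' u := ⟨_, rfl⟩
  obtain ⟨xs, hxs⟩ : ∃ x, x = L.C r1 s := ⟨_, rfl⟩
  obtain ⟨v, hvv⟩ : ∃ x, x = L.S r' d := ⟨_, rfl⟩
  obtain ⟨ys, hys⟩ : ∃ x, x = L.R d s := ⟨_, rfl⟩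
  obtain ⟨xc, hxc⟩ : ∃ x, x = L.R c v := ⟨_, rfl⟩
  obtain ⟨r2, hr2⟩ : ∃ x, x = L.R g a := ⟨_, rfl⟩
  obtain ⟨y, hy⟩ : ∃ x, x = L.S r g := ⟨_, rfl⟩
  obtain ⟨yc, hyc⟩ : ∃ x, x = L.S r2 c := ⟨_, rfl⟩
  obtain ⟨k, hk⟩ : ∃ x, x = L.C z u := ⟨_, rfl⟩
  obtain ⟨t, ht⟩ : ∃ x, x = L.C z v := ⟨_, rfl⟩
  obtain ⟨q, hq⟩ : ∃ x, x = L.S z g := ⟨_, rfl⟩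
  simp only [← hvv] at hring hreal hv hco
  simp only [← hx, ← hr1, ← hxs, ← hys, ← hxc, ← hr2, ← hy, ← hyc, ← hk, ← ht, ← hq, not_or]
    at hring hreal hv hco
  have e4 : L.S r x = u := by rw [hx]; simp
  have e5 : L.S r1 c' = u := by rw [hr1]; simp
  have e6 : L.S r1 xs = s := by rw [hxs]; simp
  have e7 : L.S r' d = v := hvv.symm
  have e8 : L.S ys d = s := by rw [hys]; simp
  have e9 : L.S xc c = v := by rw [hxc]; simp
  have e10 : L.S r2 g = a := by rw [hr2]; simp
  have e11 : L.S r g = y := hy.symm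
  have e12 : L.S r2 c = yc := hyc.symm
  have e13 : L.S z k = u := by rw [hk]; simp
  have e14 : L.S z t = v := by rw [ht]; simp
  have e15 : L.S z g = q := hq.symm
  have toGood : ∀ t, t ∉ Bad L F pr → Good L F pr t := by
    intro t ht
    simpa [Bad] using ht
  obtain ⟨v1, v2, v3, v5, v6, v8⟩ := hv
  have G1 := toGood _ v1
  have G2 := toGood _ v2
  have G3 := toGood _ v3
  have G5 := toGood _ v5
  have G6 := toGood _ v6
  have G8 := toGood _ v8
  have nf : ∀ i j, (i, j) ∉ F → i ≠ r ∧ i ≠ r' ∧ j ≠ c ∧ j ≠ c' ∧ L.S i j ≠ s ∧ L.S i j ≠ a := by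
    intro i j hij
    refine ⟨?_, ?_, ?_, ?_, ?_, ?_⟩ <;> intro h <;> exact hij (hforced _ _ (by tauto))
  obtain ⟨V, hV⟩ : ∃ V : List (α × α × α), V = [(z, x, y), (ys, xs, w), (xc, t, yc), (r1, k, w),
    (z, d, w), (r2, t, q)] := ⟨_, rfl⟩
  have hVG : ∀ t ∈ V, Good L F pr t := by
    intro t ht
    rw [hV] at ht
    simp only [List.mem_cons, List.not_mem_nil, or_false] at ht
    rcases ht with h | h | h | h | h | h <;> rw [h] <;> assumption
  have hTF : ∀ p ∈ V.flatMap (Ts L), p ∉ F := by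
    intro p hp
    obtain ⟨t, ht, hp⟩ := List.mem_flatMap.1 hp
    exact (hVG t ht).2.1 p hp
  obtain ⟨n1, n1', -⟩ := nf z x (G1.2.1 (z, x) (by simp [Ts]))
  have nx := nf z x (G1.2.1 (z, x) (by simp [Ts]))
  have n2 := nf ys xs (G2.2.1 (ys, xs) (by simp [Ts]))
  have n3 := nf xc t (G3.2.1 (xc, t) (by simp [Ts]))
  have n5 := nf r1 k (G5.2.1 (r1, k) (by simp [Ts]))
  have n6 := nf z d (G6.2.1 (z, d) (by simp [Ts]))
  have n8 := nf r2 t (G8.2.1 (r2, t) (by simp [Ts]))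
  have nw := nf z (L.C z w) (G6.2.1 (z, L.C z w) (by simp [Ts]))
  have ny := nf z (L.C z y) (G1.2.1 (z, L.C z y) (by simp [Ts]))
  have nyc := nf xc (L.C xc yc) (G3.2.1 (xc, L.C xc yc) (by simp [Ts]))
  have nA := nf z k hreal.1
  have nD := nf z t hreal.2.1
  have nE := nf z g hreal.2.2
  rw [L.SC] at nw ny nyc
  rw [e13] at nA
  rw [e14] at nD
  rw [e15] at nE
  obtain ⟨h1, h2, h3, h4, h5, h6, h7, h8, h9, h10, h11, h12, h13, h14, h15, h16, h17, h18, h19, h20,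
    h21, h22, h23, h24, h25, h26, h27, h28, h29, h30, h31, h32, h33, h34, h35, h36, h37, h38, h39⟩ := hco
  have nd21 := nodup21 L r c s a c' r' z w u d g x r1 xs v ys xc r2 y yc k t q
    (L.C z y) (L.R x y) (L.C ys w) (L.R xs w) (L.C xc yc) (L.R t yc) (L.C r1 w) (L.R k w)
    (L.C z w) (L.R d w) (L.C r2 q) (L.R t q)
    e1 e2 e3 e4 e5 e6 e7 e8 e9 e10 e11 e12 e13 e14 e15
    (by simp) (by simp) (by simp) (by simp) (by simp) (by simp) (by simp) (by simp) (by simp)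
    (by simp) (by simp) (by simp)
    G1.1 G2.1 G3.1 G5.1 G6.1 G8.1 n1 n1' nw.2.2.2.2.1 n3.2.2.1
    h1 h2 h3 h4 h5 h6 h7 h8 h9 h10 h11 h12 h13 h14 h15 h16 h17 h18 h19 h20
    h21 h22 h23 h24 h25 h26 h27 h28 h29 h30 h31 h32 h33 h34 h35 h36 h37 h38 h39
  have ndB : [(r, c), (r, c'), (r', c), (r1, c'), (r', d), (r2, g), (r, x), (r, g), (r1, xs), (ys, d),
      (xc, c), (r2, c)].Nodup := by
    have hcc : c ≠ c' := by rintro rfl; exact has (e1.symm.trans e2)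
    have hrr : r ≠ r' := by rintro rfl; exact has (e1.symm.trans e3)
    have hd1 : ¬ (r2 = r1 ∧ g = xs) := by rintro ⟨rfl, rfl⟩; exact has (e10.symm.trans e6)
    have hd2 : ¬ (r2 = ys ∧ g = d) := by rintro ⟨rfl, rfl⟩; exact has (e10.symm.trans e8)
    clear e1 e2 e3 e4 e5 e6 e7 e8 e9 e10 e11 e12 e13 e14 e15 nd21 G1 G2 G3 G5 G6 G8 hVG hTF hring hreal
    clear v1 v2 v3 v5 v6 v8 nf toGood hforced hV hI hPF hb1 hb2 hb3 hx hr1 hxs hvv hys hxc hr2 hy hyc hk ht hq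
    clear h1 h2 h3 h4 h5 h6 h7 h8 h9 h11 h12 h13 h14 h15 h16 h17 h18 h19 h20
      h21 h22 h23 h24 h25 h26 h27 h28 h30 h31 h32 h33 h34 h36 h37 h38 h39
    simp only [List.nodup_cons, List.mem_cons, Prod.mk.injEq, List.not_mem_nil, List.nodup_nil,
      or_false, not_or, not_false_eq_true, and_true]
    grind only
  obtain ⟨B, hB⟩ : ∃ B : List (α × α), B = [(r, c), (r, c'), (r', c), (r1, c'), (r', d), (r2, g),
    (r, x), (r, g), (r1, xs), (ys, d), (xc, c), (r2, c)] := ⟨_, rfl⟩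
  obtain ⟨A, hA⟩ : ∃ A : List (α × α), A = [(z, k), (z, t), (z, g)] := ⟨_, rfl⟩
  have ndA : (A ++ V.flatMap (Ts L)).Nodup := by
    rw [hA, hV]; exact nd21
  rw [← hB] at ndB
  have hAF : ∀ p ∈ A ++ V.flatMap (Ts L), p ∉ F := by
    intro p hp
    rcases List.mem_append.1 hp with h | h
    · rw [hA] at h
      simp only [List.mem_cons, List.not_mem_nil, or_false] at h
      rcases h with h | h | h <;> rw [h]
      · exact hreal.1
      · exact hreal.2.1
      · exact hreal.2.2
    · exact hTF p h
  have hBF : ∀ p ∈ B, p ∈ F := by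
    intro p hp
    rw [hB] at hp
    simp only [List.mem_cons, List.not_mem_nil, or_false] at hp
    rcases hp with h | h | h | h | h | h | h | h | h | h | h | h <;> rw [h] <;>
      apply hforced <;> simp [e6, e8, e10]
  have hBP : ∀ p ∈ B, p ∉ Prot := by
    intro p hp
    rw [hB] at hp
    simp only [List.mem_cons, List.not_mem_nil, or_false] at hp
    rcases hp with h | h | h | h | h | h | h | h | h | h | h | h <;> rw [h] <;> tauto
  have ndX : (B ++ (A ++ V.flatMap (Ts L))).Nodup := by
    refine List.nodup_append.2 ⟨ndB, ndA, ?_⟩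
    rintro p hp p' hp' rfl
    exact hAF p hp' (hBF p hp)
  have hlen : (B ++ (A ++ V.flatMap (Ts L))).length = 33 := by
    rw [hA, hB, hV]; rfl
  have hVl : V.length = 6 := by rw [hV]; rfl
  obtain ⟨I, hI1, hI2, hI3, Ad, hAd⟩ := VRs hI V (B ++ (A ++ V.flatMap (Ts L))).toFinset hVG (by
    have := List.toFinset_card_le (B ++ (A ++ V.flatMap (Ts L)))
    omega)
  refine ⟨((B ++ (A ++ V.flatMap (Ts L)) : List (α × α)) : Multiset (α × α)) + I, ?_, ?_, ?_, ?_⟩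
  · rw [Multiset.nodup_add]
    refine ⟨ndX, hI1, ?_⟩
    rw [Multiset.disjoint_left]
    intro p hp hp'
    have := (hI3 p hp').1
    rw [List.mem_toFinset] at this
    exact this hp
  · rw [Multiset.card_add, Multiset.coe_card, hlen, hI2, hVl]
  · intro p hp
    rcases Multiset.mem_add.1 hp with h | h
    · rcases List.mem_append.1 (Multiset.mem_coe.1 h) with h | h
      · exact hBP p h
      · exact fun hc => hAF p h (hPF hc)
    · exact fun hc => (hI3 p h).2 (hPF hc)
  · have hex := (bd_hex r c s a c' r' z w u d g x r1 xs v ys xc r2 y yc k t q).add (Bd.refl Ad)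
    refine ⟨_, Bd.trans (N := _) ?_ hex, ?_⟩
    · have h0 := (Bd.refl (Multiset.map L.tr (B : Multiset (α × α)) +
        Multiset.map L.tr (A : Multiset (α × α)))).add hAd
      have hl : Multiset.map L.tr (((B ++ (A ++ V.flatMap (Ts L)) : List (α × α)) :
          Multiset (α × α)) + I) = Multiset.map L.tr (B : Multiset (α × α)) +
        Multiset.map L.tr (A : Multiset (α × α)) +
          (Multiset.map L.tr (V.flatMap (Ts L) : Multiset (α × α)) + I.map L.tr) := by
        rw [← Multiset.coe_add, ← Multiset.coe_add]
        simp only [Multiset.map_add]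
        abel
      rw [hl]
      refine h0.trans ?_
      have hb : Multiset.map L.tr (B : Multiset (α × α)) = {(r, c, a)} + {(r, c', s)} +
          {(r', c, s)} + {(r1, c', u)} + {(r', d, v)} + {(r2, g, a)} +
          {(r, x, u)} + {(r, g, y)} + {(r1, xs, s)} + {(ys, d, s)} + {(xc, c, v)} + {(r2, c, yc)} := by
        rw [hB]
        simp only [Multiset.map_coe, List.map_cons, List.map_nil, LS.tr, e1, e2, e3, e4, e5, e6, e7,
          e8, e9, e10, e11, e12]
        rfl
      have ha : Multiset.map L.tr (A : Multiset (α × α)) = {(z, k, u)} + {(z, t, v)} + {(z, g, q)} := by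
        rw [hA]
        simp only [Multiset.map_coe, List.map_cons, List.map_nil, LS.tr, e13, e14, e15]
        rfl
      have hvv : (V : Multiset (α × α × α)) = {(z, x, y)} + {(ys, xs, w)} + {(xc, t, yc)} +
          {(r1, k, w)} + {(z, d, w)} + {(r2, t, q)} := by
        rw [hV]; rfl
      rw [hb, ha, hvv]
      rw [← add_assoc]
      exact Bd.refl _
    · simp
end PLS

namespace PLS
open Finset

def ProtS {α : Type} [Fintype α] [DecidableEq α] (P : α → α → Option α) (L : LS α) :
    Finset (α × α) := univ.filter fun p => P p.1 p.2 = some (L.S p.1 p.2)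

def Lines {α : Type} [Fintype α] [DecidableEq α] (L : LS α) (r r' c c' s a : α) : Finset (α × α) :=
  (univ.image fun j => (r, j)) ∪ ((univ.image fun j => (r', j)) ∪ ((univ.image fun i => (i, c)) ∪
    ((univ.image fun i => (i, c')) ∪ ((univ.image fun j => (L.R j s, j)) ∪
      (univ.image fun j => (L.R j a, j))))))

theorem Lines_card {α : Type} [Fintype α] [DecidableEq α] (L : LS α) (r r' c c' s a : α) :
    (Lines L r r' c c' s a).card ≤ 6 * Fintype.card α := by
  have h : ∀ f : α → α × α, (univ.image f).card ≤ Fintype.card α := fun f => Finset.card_image_le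
  have := ((Finset.card_union_le _ _).trans (add_le_add (h fun j => (r, j))
    ((Finset.card_union_le _ _).trans (add_le_add (h fun j => (r', j))
    ((Finset.card_union_le _ _).trans (add_le_add (h fun i => (i, c))
    ((Finset.card_union_le _ _).trans (add_le_add (h fun i => (i, c'))
    ((Finset.card_union_le _ _).trans (add_le_add (h fun j => (L.R j s, j))
      (h fun j => (L.R j a, j))))))))))))
  unfold Lines
  omega

theorem mem_Lines {α : Type} [Fintype α] [DecidableEq α] (L : LS α) (r r' c c' s a i j : α)
    (h : i = r ∨ i = r' ∨ j = c ∨ j = c' ∨ L.S i j = s ∨ L.S i j = a) :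
    (i, j) ∈ Lines L r r' c c' s a := by
  unfold Lines
  simp only [mem_union, mem_image, mem_univ, true_and, Prod.mk.injEq]
  rcases h with h | h | h | h | h | h
  · left; exact ⟨j, h.symm, rfl⟩
  · right; left; exact ⟨j, h.symm, rfl⟩
  · right; right; left; exact ⟨i, rfl, h.symm⟩
  · right; right; right; left; exact ⟨i, rfl, h.symm⟩
  · right; right; right; right; left; exact ⟨j, by rw [← h]; simp, rfl⟩
  · right; right; right; right; right; exact ⟨j, by rw [← h]; simp, rfl⟩

structure Setup {α : Type} [Fintype α] [DecidableEq α] (P : α → α → Option α) (e : ℕ)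
    (pr : α → Bool) : Prop where
  h1 : ∀ i j j' s, P i j = some s → P i j' = some s → j = j'
  h2 : ∀ i i' j s, P i j = some s → P i' j = some s → i = i'
  row : ∀ i, (univ.filter fun j => (P i j).isSome).card ≤ e
  col : ∀ j, (univ.filter fun i => (P i j).isSome).card ≤ e
  sym : ∀ s, (univ.filter fun p : α × α => P p.1 p.2 = some s).card ≤ e
  he : 10000 * e ≤ Fintype.card α
  hn : 120000 ≤ Fintype.card α
  hpr : ∀ b, Fintype.card α ≤ 2 * (univ.filter fun i => pr i = b).card + 8

theorem filled_card {α : Type} [Fintype α] [DecidableEq α] {P : α → α → Option α} {e : ℕ}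
    {pr : α → Bool} (hs : Setup P e pr) :
    (univ.filter fun p : α × α => (P p.1 p.2).isSome).card ≤ Fintype.card α * e := by
  have h : (univ.filter fun p : α × α => (P p.1 p.2).isSome).card ≤
      ∑ i : α, (univ.filter fun j => (P i j).isSome).card := by
    rw [← Finset.card_sigma]
    apply Finset.card_le_card_of_injOn (fun x => ⟨x.1, x.2⟩)
    · intro x hx
      simpa using hx
    · rintro ⟨a, b⟩ _ ⟨c, d⟩ _ h
      simp only [Sigma.mk.injEq, heq_eq_eq] at h
      rw [h.1, h.2]
  refine h.trans ((sum_le_sum fun i _ => hs.row i).trans ?_)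
  simp

theorem prot_card {α : Type} [Fintype α] [DecidableEq α] (P : α → α → Option α) (L : LS α) :
    (ProtS P L).card ≤ (univ.filter fun p : α × α => (P p.1 p.2).isSome).card := by
  apply Finset.card_le_card
  intro p hp
  simp only [ProtS, mem_filter, mem_univ, true_and] at hp ⊢
  rw [hp]; rfl

theorem step {α : Type} [Fintype α] [DecidableEq α] {P : α → α → Option α} {e : ℕ}
    {pr pc ps : α → Bool} (hs : Setup P e pr) (L : LS α) (F : Finset (α × α))
    (hI : Inv L F pr pc ps) (hF : F.card ≤ 24 * Fintype.card α + 75 * (ProtS P L).card)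
    (r c s : α) (hP : P r c = some s) (hne : L.S r c ≠ s) :
    ∃ (L' : LS α) (F' : Finset (α × α)), Inv L' F' pr pc ps ∧
      F'.card ≤ 24 * Fintype.card α + 75 * (ProtS P L').card ∧
      (ProtS P L).card < (ProtS P L').card := by
  set Prot := ProtS P L with hProt
  set c' := L.C r s with hc'
  set r' := L.R c s with hr'
  set a := L.S r c with ha
  have memP : ∀ i j, (i, j) ∈ Prot ↔ P i j = some (L.S i j) := by
    intro i j; simp [hProt, ProtS]
  have e2 : L.S r c' = s := by simp [hc']
  have e3 : L.S r' c = s := by simp [hr']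
  set Fall := (F ∪ Prot) ∪ Lines L r r' c c' s a with hFall
  have hsubP : Prot ⊆ Fall := fun x hx => by simp [hFall, hx]
  have hsubF : F ⊆ Fall := fun x hx => by simp [hFall, hx]
  have hcard : Fall.card ≤ F.card + Prot.card + 6 * Fintype.card α :=
    (card_union_le _ _).trans (add_le_add (card_union_le _ _) (Lines_card _ _ _ _ _ _ _))
  have hIF : Inv L Fall pr pc ps := hI.mono hsubF (fun _ _ _ => rfl)
  have hPc : Prot.card ≤ _ := (prot_card P L).trans (filled_card hs)
  have hrow : ∀ i, (univ.filter fun j => (i, j) ∈ Prot).card ≤ e := by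
    intro i
    refine (card_le_card ?_).trans (hs.row i)
    intro j hj
    simp only [mem_filter, mem_univ, true_and, memP] at hj ⊢
    rw [hj]; rfl
  have hcol : ∀ j, (univ.filter fun i => (i, j) ∈ Prot).card ≤ e := by
    intro j
    refine (card_le_card ?_).trans (hs.col j)
    intro i hj
    simp only [mem_filter, mem_univ, true_and, memP] at hj ⊢
    rw [hj]; rfl
  have hsym : ∀ s, (univ.filter fun j => (L.R j s, j) ∈ Prot).card ≤ e := by
    intro s
    refine le_trans ?_ (hs.sym s)
    apply Finset.card_le_card_of_injOn (fun j => (L.R j s, j))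
    · intro j hj
      simp only [coe_filter, mem_univ, true_and, memP] at hj ⊢
      simpa using hj
    · intro x _ y _ h
      simp only [Prod.mk.injEq] at h
      exact h.2
  obtain ⟨z, w, u, d, g, q1, q2, q3, q4⟩ := exists_params L r c s a c' r' Prot Fall pr e hrow hcol
    hsym hs.hn hs.hpr (by
      have h1 := hs.hn
      have h2 := hs.he
      generalize Fintype.card α = n at *
      have h4 : Fall.card ≤ 30 * n + 76 * (n * e) := by omega
      nlinarith [Nat.mul_le_mul_right n h2, Nat.mul_le_mul_right n h1])
  obtain ⟨W, hW, hWc, hWP, Add, hBd, hmem⟩ := hex_trade hIF Prot r c s a c' r' ha.symm e2 e3 hne hsubP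
    (fun i j h => by
      rw [hFall, mem_union]; right; exact mem_Lines _ _ _ _ _ _ _ _ _ h)
    (by rw [memP, hP]; intro h; exact hne (Option.some.inj h).symm)
    (by
      rw [memP, e2]; intro h
      have := hs.h1 _ _ _ _ hP h
      rw [← this] at e2
      exact hne e2)
    (by
      rw [memP, e3]; intro h
      have := hs.h2 _ _ _ _ hP h
      rw [← this] at e3
      exact hne e3)
    z w u d g q1 q2 q3 q4
  obtain ⟨L', hL', hA'⟩ := trade L W hW Add hBd
  have hlt : Prot ⊂ ProtS P L' := by
    rw [Finset.ssubset_iff_of_subset]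
    · refine ⟨(r, c), ?_, ?_⟩
      · have := hA' _ hmem
        simp only at this
        simp [ProtS, hP, this]
      · rw [memP, hP]; intro h; exact hne (Option.some.inj h).symm
    · rintro ⟨i, j⟩ hij
      have h1 := hL' i j (fun h => hWP _ h hij)
      rw [memP] at hij
      simp [ProtS, hij, h1]
  have hlt' := Finset.card_lt_card hlt
  refine ⟨L', F ∪ W.toFinset, hI.mono subset_union_left (fun i j hij => ?_), ?_, hlt'⟩
  · apply hL'
    intro h
    apply hij
    simp [h]
  · have h1 := card_union_le F W.toFinset
    have h2 := Multiset.toFinset_card_le W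
    omega

theorem main_ind {α : Type} [Fintype α] [DecidableEq α] {P : α → α → Option α} {e : ℕ}
    {pr pc ps : α → Bool} (hs : Setup P e pr) (m : ℕ) : ∀ (L : LS α) (F : Finset (α × α)),
    Inv L F pr pc ps → F.card ≤ 24 * Fintype.card α + 75 * (ProtS P L).card →
    (univ.filter fun p : α × α => (P p.1 p.2).isSome).card ≤ (ProtS P L).card + m →
    ∃ L' : LS α, ∀ i j s, P i j = some s → L'.S i j = s := by
  induction m with
  | zero =>
    intro L F hI hF hm
    by_contra hcon
    push Not at hcon
    obtain ⟨r, c, s, hP, hne⟩ := hcon L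
    obtain ⟨L', F', h1, h2, h3⟩ := step hs L F hI hF r c s hP hne
    have := prot_card P L'
    omega
  | succ m ih =>
    intro L F hI hF hm
    by_cases hcon : ∀ i j s, P i j = some s → L.S i j = s
    · exact ⟨L, hcon⟩
    · push Not at hcon
      obtain ⟨r, c, s, hP, hne⟩ := hcon
      obtain ⟨L', F', h1, h2, h3⟩ := step hs L F hI hF r c s hP hne
      exact ih L' F' h1 h2 (by omega)
end PLS

namespace PLS
open Finset

noncomputable def LS.ofInj {α : Type} [Fintype α] (S : α → α → α)
    (hr : ∀ i, Function.Injective (S i)) (hc : ∀ j, Function.Injective fun i => S i j) : LS α where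
  S := S
  C := fun i => Function.surjInv (Finite.injective_iff_surjective.1 (hr i))
  R := fun j => Function.surjInv (Finite.injective_iff_surjective.1 (hc j))
  SC := fun i s => Function.surjInv_eq _ s
  CS := fun i j => hr i (Function.surjInv_eq _ _)
  SR := fun j s => Function.surjInv_eq (f := fun i => S i j) _ s
  RS := fun i j => hc j (Function.surjInv_eq (f := fun i => S i j) _ _)
  CR := fun j s => hr _ (by
    have h := Function.surjInv_eq (f := fun i => S i j) (Finite.injective_iff_surjective.1 (hc j)) s
    have h2 := Function.surjInv_eq (Finite.injective_iff_surjective.1 (hr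
      (Function.surjInv (Finite.injective_iff_surjective.1 (hc j)) s))) s
    exact h2.trans h.symm)
  RC := fun i s => hc _ (by
    have h := Function.surjInv_eq (f := S i) (Finite.injective_iff_surjective.1 (hr i)) s
    simp only
    rw [h]
    exact Function.surjInv_eq (f := fun k => S k _) _ s)

open Classical in
/-- prolongation of a group table along disjoint transversals -/
noncomputable def proS {G T : Type} [Group G] [AddGroup T] (θ : G ≃ G) (γ : T → G) :
    G ⊕ T → G ⊕ T → G ⊕ T
  | .inl ρ, .inl c => if h : ∃ i, ρ = γ i * θ c then .inr h.choose else .inl (ρ * c)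
  | .inl ρ, .inr i => .inl (ρ * θ.symm ((γ i)⁻¹ * ρ))
  | .inr i, .inl c => .inl (γ i * θ c * c)
  | .inr i, .inr j => .inr (i + j)

theorem pro_spec {G T : Type} [Group G] [AddGroup T] (θ : G ≃ G) (γ : T → G) (ρ c : G) :
    (∃ i, ρ = γ i * θ c ∧ proS θ γ (.inl ρ) (.inl c) = .inr i) ∨
    ((∀ i, ρ ≠ γ i * θ c) ∧ proS θ γ (.inl ρ) (.inl c) = .inl (ρ * c)) := by
  by_cases h : ∃ i, ρ = γ i * θ c
  · left
    exact ⟨h.choose, h.choose_spec, by simp only [proS, dif_pos h]⟩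
  · right
    refine ⟨fun i hi => h ⟨i, hi⟩, by simp only [proS, dif_neg h]⟩

theorem pro_row {G T : Type} [Group G] [AddGroup T] (θ : G ≃ G) (γ : T → G)
    (hγ : Function.Injective γ) (hφ : Function.Injective fun c => θ c * c) (x : G ⊕ T) :
    Function.Injective (proS θ γ x) := by
  have mixed : ∀ ρ c i, proS θ γ (.inl ρ) (.inl c) ≠ proS θ γ (.inl ρ) (.inr i) := by
    intro ρ c i h
    rcases pro_spec θ γ ρ c with ⟨j, h1, h2⟩ | ⟨h1, h2⟩
    · rw [h2] at h; simp [proS] at h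
    · rw [h2] at h
      simp only [proS, Sum.inl.injEq, mul_right_inj] at h
      apply h1 i
      rw [h]; simp
  intro y y' h
  rcases x with ρ | i <;> rcases y with c | j <;> rcases y' with c' | j'
  · rcases pro_spec θ γ ρ c with ⟨j, h1, h2⟩ | ⟨h1, h2⟩ <;>
    rcases pro_spec θ γ ρ c' with ⟨j', h1', h2'⟩ | ⟨h1', h2'⟩ <;> rw [h2, h2'] at h
    · simp only [Sum.inr.injEq] at h
      subst h
      rw [h1] at h1'
      simpa using h1'
    · simp at h
    · simp at h
    · simpa using h
  · exact absurd h (mixed _ _ _)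
  · exact absurd h.symm (mixed _ _ _)
  · simp only [proS, Sum.inl.injEq, mul_right_inj, EmbeddingLike.apply_eq_iff_eq, mul_left_inj,
      inv_inj] at h
    rw [hγ h]
  · simp only [proS, Sum.inl.injEq, mul_assoc, mul_right_inj] at h
    rw [hφ h]
  · simp [proS] at h
  · simp [proS] at h
  · simpa [proS] using h

theorem pro_col {G T : Type} [Group G] [AddGroup T] (θ : G ≃ G) (γ : T → G)
    (hγ : Function.Injective γ) (hφ : Function.Injective fun c => θ c * c) (y : G ⊕ T) :
    Function.Injective fun x => proS θ γ x y := by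
  have mixed : ∀ ρ c i, proS θ γ (.inl ρ) (.inl c) ≠ proS θ γ (.inr i) (.inl c) := by
    intro ρ c i h
    rcases pro_spec θ γ ρ c with ⟨j, h1, h2⟩ | ⟨h1, h2⟩
    · rw [h2] at h; simp [proS] at h
    · rw [h2] at h
      simp only [proS, Sum.inl.injEq, mul_left_inj] at h
      exact h1 i h
  intro x x' h
  simp only at h
  rcases y with c | i <;> rcases x with ρ | j <;> rcases x' with ρ' | j'
  · rcases pro_spec θ γ ρ c with ⟨j, h1, h2⟩ | ⟨h1, h2⟩ <;>
    rcases pro_spec θ γ ρ' c with ⟨j', h1', h2'⟩ | ⟨h1', h2'⟩ <;> rw [h2, h2'] at h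
    · simp only [Sum.inr.injEq] at h
      subst h
      rw [h1, h1']
    · simp at h
    · simp at h
    · simpa using h
  · exact absurd h (mixed _ _ _)
  · exact absurd h.symm (mixed _ _ _)
  · simp only [proS, Sum.inl.injEq, mul_left_inj] at h
    rw [hγ h]
  · simp only [proS, Sum.inl.injEq] at h
    have key : ∀ ρ, ρ = γ i * θ (θ.symm ((γ i)⁻¹ * ρ)) := by intro ρ; simp
    have h2 : θ.symm ((γ i)⁻¹ * ρ) = θ.symm ((γ i)⁻¹ * ρ') := by
      apply hφ
      simp only [Equiv.apply_symm_apply, mul_assoc, h]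
    simpa using h2
  · simp [proS] at h
  · simp [proS] at h
  · simpa [proS] using h

abbrev Gp (h : ℕ) := DihedralGroup h × ℤˣ

def par {h : ℕ} : Gp h → Bool
  | (.r _, _) => false
  | (.sr _, _) => true

theorem par_mul {h : ℕ} (x y : Gp h) : par (x * y) = xor (par x) (par y) := by
  obtain ⟨x | x, f⟩ := x <;> obtain ⟨y | y, g⟩ := y <;> simp [par]

theorem par_inv {h : ℕ} (x : Gp h) : par x⁻¹ = par x := by
  have := par_mul x x⁻¹
  rw [mul_inv_cancel] at this
  have h1 : par (1 : Gp h) = false := rfl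
  rw [h1] at this
  revert this
  cases par x <;> cases par x⁻¹ <;> simp

theorem odd_sq {h : ℕ} (x : Gp h) (hx : par x = true) : x * x = 1 := by
  obtain ⟨x | x, f⟩ := x
  · simp [par] at hx
  · have : f * f = 1 := Int.units_mul_self f
    simp only [Prod.mk_mul_mk, DihedralGroup.sr_mul_sr, this, sub_self]
    rfl

def thetaF {h : ℕ} : Gp h → Gp h
  | (.r a, f) => if f = 1 then (.r a, 1) else (.sr a, -1)
  | (.sr a, f) => if f = 1 then (.r (-a), -1) else (.sr (-a), 1)

theorem neg_one_ne : (-1 : ℤˣ) ≠ 1 := by decide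

theorem thetaF_inj {h : ℕ} : Function.Injective (thetaF (h := h)) := by
  have hne := neg_one_ne
  rintro ⟨x | x, f⟩ ⟨y | y, g⟩ <;> rcases Int.units_eq_one_or f with rfl | rfl <;>
    rcases Int.units_eq_one_or g with rfl | rfl <;> simp [thetaF, hne, hne.symm]

theorem phi_inj {h : ℕ} (hodd : Odd h) : Function.Injective (fun c : Gp h => thetaF c * c) := by
  have hne := neg_one_ne
  have h2 : ∀ x y : ZMod h, x + x = y + y → x = y := by
    intro x y hxy
    obtain ⟨m, hm⟩ := hodd
    have hz : ((2 * m + 1 : ℕ) : ZMod h) = 0 := by rw [← hm]; simp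
    push_cast at hz
    have : ∀ w : ZMod h, w = (m + 1) * (w + w) := by
      intro w
      have : (m + 1) * (w + w) = w + (2 * m + 1) * w := by ring
      rw [this, hz]; ring
    rw [this x, this y, hxy]
  rintro ⟨x | x, f⟩ ⟨y | y, g⟩ <;> rcases Int.units_eq_one_or f with rfl | rfl <;>
    rcases Int.units_eq_one_or g with rfl | rfl <;>
    simp [thetaF, hne, hne.symm] <;> exact h2 x y

theorem init_sq (h t : ℕ) [NeZero h] [NeZero t] (hodd : Odd h) (ht : t ≤ 8) (hh : 2 ≤ h) :
    ∃ (L : LS (Gp h ⊕ ZMod t)) (F : Finset ((Gp h ⊕ ZMod t) × (Gp h ⊕ ZMod t)))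
      (p : Gp h ⊕ ZMod t → Bool), Inv L F p p p ∧ F.card ≤ 24 * Fintype.card (Gp h ⊕ ZMod t) ∧
      ∀ b, Fintype.card (Gp h ⊕ ZMod t) ≤ 2 * (univ.filter fun i => p i = b).card + 8 := by
  classical
  have hcG : Fintype.card (Gp h) = 4 * h := by
    rw [Fintype.card_prod, DihedralGroup.card, Fintype.card_units_int]; ring
  have hcT : Fintype.card (ZMod t) = t := ZMod.card t
  obtain ⟨γ⟩ : Nonempty (ZMod t ↪ Gp h) := Function.Embedding.nonempty_of_card_le (by
    rw [hcG, hcT]; omega)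
  set θ : Gp h ≃ Gp h := Equiv.ofBijective thetaF (Finite.injective_iff_bijective.1 thetaF_inj) with hθ
  have hφ : Function.Injective fun c => θ c * c := phi_inj hodd
  obtain ⟨L, hL⟩ : ∃ L : LS (Gp h ⊕ ZMod t), L.S = proS θ γ :=
    ⟨LS.ofInj (proS θ γ) (pro_row θ γ γ.injective hφ) (pro_col θ γ γ.injective hφ), rfl⟩
  set p : Gp h ⊕ ZMod t → Bool := fun x => Sum.elim par (fun _ => false) x with hp
  set F : Finset ((Gp h ⊕ ZMod t) × (Gp h ⊕ ZMod t)) :=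
    (univ.image fun q : ZMod t × (Gp h ⊕ ZMod t) => (.inr q.1, q.2)) ∪
    ((univ.image fun q : ZMod t × (Gp h ⊕ ZMod t) => (q.2, .inr q.1)) ∪
    (univ.image fun q : ZMod t × (Gp h ⊕ ZMod t) => (L.R q.2 (.inr q.1), q.2))) with hF
  have hnF : ∀ i j, (i, j) ∉ F → ∃ ρ c, i = .inl ρ ∧ j = .inl c ∧ L.S i j = .inl (ρ * c) := by
    intro i j hij
    simp only [hF, mem_union, mem_image, mem_univ, true_and, not_or, not_exists, Prod.mk.injEq] at hij
    obtain ⟨h1, h2, h3⟩ := hij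
    rcases i with ρ | i
    · rcases j with c | j
      · refine ⟨ρ, c, rfl, rfl, ?_⟩
        rcases pro_spec θ γ ρ c with ⟨k, -, hk⟩ | ⟨-, hk⟩
        · exfalso
          apply h3 (k, .inl c)
          refine ⟨?_, rfl⟩
          rw [← hk, ← hL]; simp
        · rw [hL, hk]
      · exact absurd ⟨rfl, rfl⟩ (h2 (j, .inl ρ))
    · exact absurd ⟨rfl, rfl⟩ (h1 (i, j))
  refine ⟨L, F, p, ⟨?_, ?_⟩, ?_, ?_⟩
  · intro i j hij
    obtain ⟨ρ, c, rfl, rfl, h⟩ := hnF i j hij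
    rw [h]
    exact par_mul ρ c
  · intro i j i' j' h1 h2 h3 h4 h5 h6
    obtain ⟨ρ, c, rfl, rfl, q1⟩ := hnF i j h1
    obtain ⟨ρ', c', rfl, rfl, q4⟩ := hnF i' j' h4
    obtain ⟨_, _, e2, e2', q2⟩ := hnF _ _ h2
    obtain ⟨_, _, e3, e3', q3⟩ := hnF _ _ h3
    cases e2; cases e2'; cases e3; cases e3'
    rw [q1, q4]
    rw [q2, q3] at h5
    simp only [Sum.inl.injEq] at h5
    have h6' : par ρ ≠ par ρ' := h6
    have hodd' : par (ρ'⁻¹ * ρ) = true := by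
      rw [par_mul, par_inv]
      revert h6'
      cases par ρ <;> cases par ρ' <;> simp
    have hsq := odd_sq _ hodd'
    have hc : c = ρ'⁻¹ * ρ * c' := by rw [mul_assoc, h5]; simp
    have : ρ * c = ρ' * ((ρ'⁻¹ * ρ) * (ρ'⁻¹ * ρ)) * c' := by
      rw [hc]; group
    rw [this, hsq]; simp
  · have hi : ∀ f : ZMod t × (Gp h ⊕ ZMod t) → (Gp h ⊕ ZMod t) × (Gp h ⊕ ZMod t),
        (univ.image f).card ≤ t * Fintype.card (Gp h ⊕ ZMod t) := by
      intro f
      refine Finset.card_image_le.trans ?_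
      rw [Finset.card_univ, Fintype.card_prod, hcT]
    have := (card_union_le _ _).trans (add_le_add (hi fun q => (.inr q.1, q.2))
      ((card_union_le _ _).trans (add_le_add (hi fun q => (q.2, .inr q.1))
        (hi fun q => (L.R q.2 (.inr q.1), q.2)))))
    refine this.trans ?_
    nlinarith [Nat.mul_le_mul_right (Fintype.card (Gp h ⊕ ZMod t)) ht]
  · intro b
    have hcard : 2 * h ≤ (univ.filter fun i => p i = b).card := by
      have : (univ : Finset (ZMod h × ℤˣ)).card = 2 * h := by
        rw [Finset.card_univ, Fintype.card_prod, ZMod.card, Fintype.card_units_int]; ring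
      rw [← this]
      cases b
      · apply Finset.card_le_card_of_injOn (fun x => .inl (.r x.1, x.2))
        · intro x _; simp [hp, par]
        · rintro ⟨x, f⟩ _ ⟨y, g⟩ _ h; simpa using h
      · apply Finset.card_le_card_of_injOn (fun x => .inl (.sr x.1, x.2))
        · intro x _; simp [hp, par]
        · rintro ⟨x, f⟩ _ ⟨y, g⟩ _ h; simpa using h
    rw [Fintype.card_sum, hcG, hcT]
    omega

theorem transfer {α β : Type} [Fintype α] [Fintype β] [DecidableEq α] [DecidableEq β] (σ : β ≃ α)
    (L : LS α) (F : Finset (α × α)) (p : α → Bool) (hI : Inv L F p p p)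
    (hF : F.card ≤ 24 * Fintype.card α)
    (hp : ∀ b, Fintype.card α ≤ 2 * (univ.filter fun i => p i = b).card + 8) :
    ∃ (L' : LS β) (F' : Finset (β × β)) (p' : β → Bool), Inv L' F' p' p' p' ∧
      F'.card ≤ 24 * Fintype.card β ∧
      ∀ b, Fintype.card β ≤ 2 * (univ.filter fun i => p' i = b).card + 8 := by
  have hc : Fintype.card β = Fintype.card α := Fintype.card_congr σ
  refine ⟨⟨fun i j => σ.symm (L.S (σ i) (σ j)), fun i j => σ.symm (L.C (σ i) (σ j)),
    fun i j => σ.symm (L.R (σ i) (σ j)), by simp, by simp, by simp, by simp, by simp, by simp⟩,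
    univ.filter fun q => (σ q.1, σ q.2) ∈ F, fun i => p (σ i), ⟨?_, ?_⟩, ?_, ?_⟩
  · intro i j hij
    simp only [mem_filter, mem_univ, true_and] at hij
    simpa using hI.a _ _ hij
  · intro i j i' j' h1 h2 h3 h4 h5 h6
    simp only [mem_filter, mem_univ, true_and] at h1 h2 h3 h4
    simp only [EmbeddingLike.apply_eq_iff_eq] at h5 ⊢
    exact hI.b _ _ _ _ h1 h2 h3 h4 h5 h6
  · rw [hc]
    refine le_trans ?_ hF
    apply Finset.card_le_card_of_injOn (fun q => (σ q.1, σ q.2))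
    · intro q hq; simpa using hq
    · rintro ⟨a, b⟩ _ ⟨c, d⟩ _ h; simpa using h
  · intro b
    rw [hc]
    refine (hp b).trans ?_
    have : (univ.filter fun i => p i = b).card ≤ (univ.filter fun i => p (σ i) = b).card := by
      apply Finset.card_le_card_of_injOn σ.symm
      · intro q hq; simpa using hq
      · exact σ.symm.injective.injOn
    beta_reduce
    omega

theorem init_fin (n : ℕ) (hn : 120000 ≤ n) :
    ∃ (L' : LS (Fin n)) (F' : Finset (Fin n × Fin n)) (p' : Fin n → Bool), Inv L' F' p' p' p' ∧
      F'.card ≤ 24 * Fintype.card (Fin n) ∧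
      ∀ b, Fintype.card (Fin n) ≤ 2 * (univ.filter fun i => p' i = b).card + 8 := by
  obtain ⟨h, hh⟩ : ∃ h, h = 2 * ((n - 5) / 8) + 1 := ⟨_, rfl⟩
  obtain ⟨t, ht⟩ : ∃ t, t = n - 4 * h := ⟨_, rfl⟩
  haveI : NeZero h := ⟨by omega⟩
  haveI : NeZero t := ⟨by omega⟩
  obtain ⟨L, F, p, h1, h2, h3⟩ := init_sq h t ⟨_, hh⟩ (by omega) (by omega)
  have hc : Fintype.card (Fin n) = Fintype.card (Gp h ⊕ ZMod t) := by
    rw [Fintype.card_sum, Fintype.card_prod, DihedralGroup.card, Fintype.card_units_int, ZMod.card,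
      Fintype.card_fin]
    omega
  classical
  exact transfer (Fintype.equivOfCardEq hc) L F p h1 h2 h3
end PLS

/-- For `n > 1.2 · 10⁵`, every `10⁻⁴`-dense partial latin square of order `n`
is completable. -/
theorem dense_partial_latin_square_completable_large_n
    (n : ℕ) (hn : 120000 < n) (P : Fin n → Fin n → Option (Fin n))
    (hP : IsPartialLatinSquare P) (hdense : IsEpsDense (10 ^ (-4 : ℤ)) P) :
    ∃ L : Fin n → Fin n → Fin n, IsLatinSquare L ∧ Completes L P := by
  obtain ⟨L, F, p, hI, hF, hp⟩ := PLS.init_fin n hn.le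
  have key : ∀ c : ℕ, (c : ℝ) ≤ 10 ^ (-4 : ℤ) * n → c ≤ n / 10000 := by
    intro c hc
    rw [Nat.le_div_iff_mul_le (by norm_num)]
    have h : (c : ℝ) * 10000 ≤ n := by
      norm_num at hc
      linarith
    exact_mod_cast h
  obtain ⟨d1, d2, d3⟩ := hdense
  have hs : PLS.Setup P (n / 10000) p :=
    { h1 := hP.1
      h2 := hP.2
      row := fun i => key _ (d1 i)
      col := fun j => key _ (d2 j)
      sym := fun s => key _ (by convert d3 s)
      he := by rw [Fintype.card_fin]; omega
      hn := by rw [Fintype.card_fin]; omega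
      hpr := hp }
  obtain ⟨L', hL'⟩ := PLS.main_ind hs _ L F hI (by omega) (Nat.le_add_left _ _)
  refine ⟨L'.S, ⟨fun i => ⟨?_, fun s => ⟨L'.C i s, L'.SC i s⟩⟩,
    fun j => ⟨?_, fun s => ⟨L'.R j s, L'.SR j s⟩⟩⟩, hL'⟩
  · intro a b h
    rw [← L'.CS i a, h, L'.CS]
  · intro a b h
    have h' : L'.S a j = L'.S b j := h
    rw [← L'.RS a j, h', L'.RS]
end

section
/- For every positive integer m, letting n = 2m, the Chetwynd–Häggkvist square L_n is a latin square of order n: every row and every column of L_n contains each of the n symbols exactly once. -/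
/-- The Chetwynd–Häggkvist square of order `n = 2*m` (0-indexed):
`(j-i) % m` in the top-left quadrant, `(i-j) % m` in the bottom-right,
`m + (j-i) % m` in the top-right, `m + (i-j) % m` in the bottom-left. -/
def CHsq (m : ℕ) (i j : Fin (2 * m)) : Fin (2 * m) :=
  have hm : 0 < m := by have := i.isLt; omega
  if i.val < m then
    if j.val < m then
      ⟨(j.val + 2 * m - i.val) % m, by have := Nat.mod_lt (j.val + 2 * m - i.val) hm; omega⟩
    else
      ⟨m + (j.val + 2 * m - i.val) % m, by have := Nat.mod_lt (j.val + 2 * m - i.val) hm; omega⟩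
  else
    if j.val < m then
      ⟨m + (i.val + 2 * m - j.val) % m, by have := Nat.mod_lt (i.val + 2 * m - j.val) hm; omega⟩
    else
      ⟨(i.val + 2 * m - j.val) % m, by have := Nat.mod_lt (i.val + 2 * m - j.val) hm; omega⟩

/-- Two naturals congruent mod `m` at distance less than `m` are equal. -/
lemma CH_eq_of_mod {m a b : ℕ} (h : a % m = b % m) (h1 : a < b + m) (h2 : b < a + m) :
    a = b := by
  rcases le_total a b with hab | hab
  · have hd := (Nat.modEq_iff_dvd' hab).1 h
    have := Nat.eq_zero_of_dvd_of_lt hd (by omega)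
    omega
  · have hd := (Nat.modEq_iff_dvd' hab).1 h.symm
    have := Nat.eq_zero_of_dvd_of_lt hd (by omega)
    omega

/-- The Chetwynd–Häggkvist square of order `n = 2m` is a latin square. -/
theorem CHsq_isLatinSquare (m : ℕ) (hm : 0 < m) : IsLatinSquare (CHsq m) := by
  have key : ∀ a b : ℕ, a % m = b % m → a < b + m → b < a + m → a = b :=
    fun a b => CH_eq_of_mod
  constructor
  · intro i
    refine Finite.injective_iff_bijective.1 fun j k h => ?_
    have hi := i.isLt
    have hj := j.isLt
    have hk := k.isLt
    have k1 := key (j.val + 2 * m - i.val) (k.val + 2 * m - i.val)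
    have k2 := key (i.val + 2 * m - j.val) (i.val + 2 * m - k.val)
    have l1 := Nat.mod_lt (j.val + 2 * m - i.val) hm
    have l2 := Nat.mod_lt (k.val + 2 * m - i.val) hm
    have l3 := Nat.mod_lt (i.val + 2 * m - j.val) hm
    have l4 := Nat.mod_lt (i.val + 2 * m - k.val) hm
    simp only [CHsq] at h
    apply Fin.ext
    split_ifs at h <;> simp only [Fin.mk.injEq] at h <;> omega
  · intro j
    refine Finite.injective_iff_bijective.1 fun i k h => ?_
    have hi := i.isLt
    have hj := j.isLt
    have hk := k.isLt
    have k1 := key (j.val + 2 * m - i.val) (j.val + 2 * m - k.val)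
    have k2 := key (i.val + 2 * m - j.val) (k.val + 2 * m - j.val)
    have l1 := Nat.mod_lt (j.val + 2 * m - i.val) hm
    have l2 := Nat.mod_lt (j.val + 2 * m - k.val) hm
    have l3 := Nat.mod_lt (i.val + 2 * m - j.val) hm
    have l4 := Nat.mod_lt (k.val + 2 * m - j.val) hm
    simp only [CHsq] at h
    apply Fin.ext
    split_ifs at h <;> simp only [Fin.mk.injEq] at h <;> omega
end

section
/- Let m be a positive integer, n = 2m, and L = L_n the Chetwynd–Häggkvist square of order n. For every cell (i,j) and every column j' in the opposite half from j (i.e., j < m if and only if j' ≥ m), there exists a row i' ≠ i such that L i' j' = L i j and L i j' = L i' j. Consequently, every cell of L_n is contained in at least m distinct 2×2 subsquares of L_n. -/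
theorem CHsq_aux_mod {m a b p q : ℕ} (h : a + m * p = b + m * q) : a % m = b % m := by
  have := congrArg (· % m) h
  simpa [Nat.add_mul_mod_self_left] using this

theorem CHsq_aux_val (m : ℕ) (i j : Fin (2 * m)) :
    (CHsq m i j).val = if i.val < m then
      (if j.val < m then (j.val + 2 * m - i.val) % m else m + (j.val + 2 * m - i.val) % m)
      else (if j.val < m then m + (i.val + 2 * m - j.val) % m
        else (i.val + 2 * m - j.val) % m) := by
  unfold CHsq
  split_ifs <;> rfl

theorem CHsq_aux_first (m : ℕ) (hm : 0 < m) (i j j' : Fin (2 * m))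
    (h : j.val < m ↔ m ≤ j'.val) :
    ∃ i' : Fin (2 * m), i' ≠ i ∧ CHsq m i' j' = CHsq m i j ∧ CHsq m i j' = CHsq m i' j := by
  have hi := i.isLt
  have hj := j.isLt
  have hj' := j'.isLt
  obtain ⟨x, hx⟩ : ∃ x, x = j.val + j'.val + 2 * m - i.val := ⟨_, rfl⟩
  have ht := Nat.mod_lt x hm
  have hd := Nat.mod_add_div x m
  generalize x % m = t at ht hd
  generalize x / m = q at hd
  by_cases him : i.val < m
  · refine ⟨⟨t + m, by omega⟩, ?_, ?_, ?_⟩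
    · intro e
      have := congrArg Fin.val e
      simp only at this
      omega
    all_goals
      apply Fin.ext
      rw [CHsq_aux_val, CHsq_aux_val]
      have h2 : ¬ (t + m < m) := by omega
      simp only [him, h2, if_true, if_false]
      by_cases hjm : j.val < m
      · have h3 : ¬ (j'.val < m) := by omega
        simp only [hjm, h3, if_true, if_false]
        first
          | exact CHsq_aux_mod (p := q) (q := 3) (by omega)
          | (congr 1; exact (CHsq_aux_mod (p := 3) (q := q) (by omega)))
      · have h3 : j'.val < m := by omega
        simp only [hjm, h3, if_true, if_false]
        first
          | (congr 1; exact CHsq_aux_mod (p := q) (q := 3) (by omega))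
          | exact (CHsq_aux_mod (p := 3) (q := q) (by omega))
  · refine ⟨⟨t, by omega⟩, ?_, ?_, ?_⟩
    · intro e
      have := congrArg Fin.val e
      simp only at this
      omega
    all_goals
      apply Fin.ext
      rw [CHsq_aux_val, CHsq_aux_val]
      simp only [him, ht, if_true, if_false]
      by_cases hjm : j.val < m
      · have h3 : ¬ (j'.val < m) := by omega
        simp only [hjm, h3, if_true, if_false]
        first
          | (congr 1; exact CHsq_aux_mod (p := 2) (q := q) (by omega))
          | exact (CHsq_aux_mod (p := q) (q := 2) (by omega))
      · have h3 : j'.val < m := by omega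
        simp only [hjm, h3, if_true, if_false]
        first
          | exact CHsq_aux_mod (p := 2) (q := q) (by omega)
          | (congr 1; exact CHsq_aux_mod (p := q) (q := 2) (by omega))

/-- In the Chetwynd–Häggkvist square, for every cell `(i, j)` and every column
`j'` in the opposite half from `j`, there is a row `i' ≠ i` with
`L i' j' = L i j` and `L i j' = L i' j`; consequently every cell lies in at
least `m` distinct 2×2 subsquares. -/
theorem CHsq_intercalates (m : ℕ) (hm : 0 < m) :
    (∀ i j j' : Fin (2 * m), (j.val < m ↔ m ≤ j'.val) →
      ∃ i' : Fin (2 * m), i' ≠ i ∧ CHsq m i' j' = CHsq m i j ∧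
        CHsq m i j' = CHsq m i' j) ∧
    ∀ i j : Fin (2 * m),
      m ≤ (Finset.univ.filter fun p : Fin (2 * m) × Fin (2 * m) =>
        p.1 ≠ i ∧ p.2 ≠ j ∧ CHsq m p.1 p.2 = CHsq m i j ∧
          CHsq m i p.2 = CHsq m p.1 j).card := by
  refine ⟨CHsq_aux_first m hm, fun i j => ?_⟩
  have key : ∀ k : Fin m, ∃ p : Fin (2 * m) × Fin (2 * m),
      p.2.val = (if j.val < m then k.val + m else k.val) ∧
      (p.1 ≠ i ∧ p.2 ≠ j ∧ CHsq m p.1 p.2 = CHsq m i j ∧ CHsq m i p.2 = CHsq m p.1 j) := by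
    intro k
    have hk := k.isLt
    obtain ⟨c, hc⟩ : ∃ c : Fin (2 * m), c.val = (if j.val < m then k.val + m else k.val) :=
      ⟨⟨if j.val < m then k.val + m else k.val, by split_ifs <;> omega⟩, rfl⟩
    have hiff : j.val < m ↔ m ≤ c.val := by
      rw [hc]; split_ifs <;> omega
    obtain ⟨i', h1, h2, h3⟩ := CHsq_aux_first m hm i j c hiff
    refine ⟨(i', c), hc, h1, ?_, h2, h3⟩
    rintro rfl
    simp only at hiff
    omega
  choose f hf hg using key
  calc m = (Finset.univ : Finset (Fin m)).card := by simp
    _ ≤ _ := by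
      apply Finset.card_le_card_of_injOn f
      · intro k _
        simpa using hg k
      · intro a _ b _ hab
        have h1 := hf a
        rw [hab, hf b] at h1
        apply Fin.ext
        split_ifs at h1 <;> omega
end

section
/- Let m be a positive integer, n = 2m, and L = L_n the Chetwynd–Häggkvist square of order n. Suppose the cells (i,j) and (i',j') lie in diagonally opposite quadrants, i.e., (i < m if and only if i' ≥ m) and (j < m if and only if j' ≥ m). If L i j = L i' j', then L i j' = L i' j; that is, the four cells (i,j), (i,j'), (i',j), (i',j') form a 2×2 subsquare, so there is a 2×2 trade exchanging the contents of (i,j) and (i',j'). -/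
theorem CHsq_aux (m a b c d : ℕ) (ha : a < 2 * m) (hb : b < 2 * m) (hd : d < 2 * m)
    (h : (a + 2 * m - b) % m = (c + 2 * m - d) % m) :
    (d + 2 * m - b) % m = (c + 2 * m - a) % m := by
  have h' : (a + 2 * m - b) ≡ (c + 2 * m - d) [MOD m] := h
  change (d + 2 * m - b) ≡ (c + 2 * m - a) [MOD m]
  rw [Nat.modEq_iff_dvd] at h' ⊢
  rw [Nat.cast_sub (by omega), Nat.cast_sub (by omega)] at h' ⊢
  push_cast at h' ⊢
  obtain ⟨k, hk⟩ := h'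
  exact ⟨k, by linarith⟩

/-- In the Chetwynd–Häggkvist square, if two cells `(i, j)` and `(i', j')` in
diagonally opposite quadrants contain the same symbol, then the four cells
`(i,j), (i,j'), (i',j), (i',j')` form a 2×2 subsquare. -/
theorem CHsq_opposite_quadrant_subsquare (m : ℕ) (hm : 0 < m)
    (i i' j j' : Fin (2 * m))
    (hrow : i.val < m ↔ m ≤ i'.val) (hcol : j.val < m ↔ m ≤ j'.val)
    (hsym : CHsq m i j = CHsq m i' j') :
    CHsq m i j' = CHsq m i' j := by
  have h1 := i.isLt
  have h2 := i'.isLt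
  have h3 := j.isLt
  have h4 := j'.isLt
  by_cases hi : i.val < m <;> by_cases hj : j.val < m
  · have hi' : ¬ i'.val < m := by omega
    have hj' : ¬ j'.val < m := by omega
    simp only [CHsq, hi, hj, hi', hj', if_true, if_false, Fin.mk.injEq] at hsym ⊢
    have := CHsq_aux m j i i' j' h3 h1 h4 (by omega)
    omega
  · have hi' : ¬ i'.val < m := by omega
    have hj' : j'.val < m := by omega
    simp only [CHsq, hi, hj, hi', hj', if_true, if_false, Fin.mk.injEq] at hsym ⊢
    have := CHsq_aux m j i i' j' h3 h1 h4 (by omega)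
    omega
  · have hi' : i'.val < m := by omega
    have hj' : ¬ j'.val < m := by omega
    simp only [CHsq, hi, hj, hi', hj', if_true, if_false, Fin.mk.injEq] at hsym ⊢
    have := CHsq_aux m j' i' i j h4 h2 h3 (by omega)
    omega
  · have hi' : i'.val < m := by omega
    have hj' : j'.val < m := by omega
    simp only [CHsq, hi, hj, hi', hj', if_true, if_false, Fin.mk.injEq] at hsym ⊢
    have := CHsq_aux m j' i' i j h4 h2 h3 (by omega)
    omega
end

section
/- Let k be a positive integer, n = 4k, and L = L_n the Chetwynd–Häggkvist square of order n (0-indexed). Define σ : Fin n → Fin n by σ(i) = 2i for 0 ≤ i ≤ 2k−1, σ(i) = 2i − 2k + 1 for 2k ≤ i ≤ 3k−1, and σ(i) = 2i − 6k + 1 for 3k ≤ i ≤ 4k−1. Then σ is a permutation of Fin n, and the cells (i, σ(i)) for i ∈ Fin n form a transversal of L: the n symbols L(i, σ(i)) are pairwise distinct. -/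
/-- The permutation `σ` of `Fin (4k)` given by `σ(i) = 2i` for `i < 2k`,
`σ(i) = 2i - 2k + 1` for `2k ≤ i < 3k`, and `σ(i) = 2i - 6k + 1` for
`3k ≤ i < 4k`. -/
def chTransversalMap (k : ℕ) : Fin (2 * (2 * k)) → Fin (2 * (2 * k)) := fun i =>
  if h1 : i.val < 2 * k then ⟨2 * i.val, by omega⟩
  else if h2 : i.val < 3 * k then ⟨2 * i.val - 2 * k + 1, by have := i.isLt; omega⟩
  else ⟨2 * i.val - 6 * k + 1, by have := i.isLt; omega⟩

/-- The values of `σ`. -/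
theorem chMap_val (k : ℕ) (i : Fin (2 * (2 * k))) :
    (chTransversalMap k i).val = if i.val < 2 * k then 2 * i.val
      else if i.val < 3 * k then 2 * i.val - 2 * k + 1 else 2 * i.val - 6 * k + 1 := by
  unfold chTransversalMap
  split_ifs <;> rfl

theorem mod_shift (a b m q : ℕ) (hb : b < m) (h : a = b + m * q) : a % m = b := by
  rw [h, Nat.add_mul_mod_self_left, Nat.mod_eq_of_lt hb]

/-- The symbols on the transversal. -/
theorem chSymbol_val (k : ℕ) (i : Fin (2 * (2 * k))) :
    (CHsq (2 * k) i (chTransversalMap k i)).val =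
      if i.val < k then i.val else if i.val < 2 * k then 2 * k + i.val
      else if i.val < 3 * k then 4 * k - 1 - i.val else 6 * k - 1 - i.val := by
  have hi := i.isLt
  have hv := chMap_val k i
  unfold CHsq
  by_cases h1 : i.val < k
  · have h2 : i.val < 2 * k := by omega
    rw [if_pos h2] at hv
    have h3 : (chTransversalMap k i).val < 2 * k := by omega
    simp only [h1, h2, h3, if_true]
    exact mod_shift _ _ _ 2 (by omega) (by omega)
  by_cases h2 : i.val < 2 * k
  · rw [if_pos h2] at hv
    have h3 : ¬ (chTransversalMap k i).val < 2 * k := by omega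
    simp only [h1, h2, h3, if_true, if_false]
    rw [mod_shift _ i.val _ 2 (by omega) (by omega)]
  by_cases h4 : i.val < 3 * k
  · rw [if_neg h2, if_pos h4] at hv
    have h3 : ¬ (chTransversalMap k i).val < 2 * k := by omega
    simp only [h1, h2, h3, h4, if_true, if_false]
    exact mod_shift _ _ _ 1 (by omega) (by omega)
  · rw [if_neg h2, if_neg h4] at hv
    have h3 : (chTransversalMap k i).val < 2 * k := by omega
    simp only [h1, h2, h3, h4, if_true, if_false]
    rw [mod_shift _ (4 * k - 1 - i.val) _ 3 (by omega) (by omega)]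
    omega

/-- For `n = 4k`, the map `σ` is a permutation of `Fin n` and the cells
`(i, σ i)` form a transversal of the Chetwynd–Häggkvist square of order `n`:
the symbols `L (i, σ i)` are pairwise distinct. -/
theorem CHsq_transversal (k : ℕ) (hk : 0 < k) :
    Function.Bijective (chTransversalMap k) ∧
    Function.Injective (fun i : Fin (2 * (2 * k)) =>
      CHsq (2 * k) i (chTransversalMap k i)) := by
  constructor
  · rw [← Finite.injective_iff_bijective]
    intro i j h
    have h' := congrArg Fin.val h
    rw [chMap_val, chMap_val] at h'
    have := i.isLt
    have := j.isLt
    apply Fin.ext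
    split_ifs at h' <;> omega
  · intro i j h
    have h' := congrArg Fin.val h
    simp only [chSymbol_val] at h'
    have := i.isLt
    have := j.isLt
    apply Fin.ext
    split_ifs at h' <;> omega
end

section
/- For every positive integer k, letting n = 4k + 1, there exists a latin square L of order n and a set B of cells with |B| ≤ 3n − 2 such that every cell of L outside B is contained in at least 2k − 2 distinct 2×2 subsquares of L. -/
section Prolong

variable {G : Type*} [Group G] [Fintype G] [DecidableEq G]

/-- Prolongation of the Cayley table of `G` along the transversal given by `θ`. -/
def prolong (θ η : G ≃ G) : Option G → Option G → Option G
  | some a, some b => if b = θ a then none else some (a * b)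
  | some a, none => some (η a)
  | none, some b => some (η (θ.symm b))
  | none, none => none

lemma prolong_row (θ η : G ≃ G) (h : ∀ a, η a = a * θ a) (i : Option G) :
    Function.Injective (prolong θ η i) := by
  intro x y hxy
  rcases i with _ | a <;> rcases x with _ | b <;> rcases y with _ | c <;>
    simp only [prolong] at hxy
  · rfl
  · simp at hxy
  · simp at hxy
  · simpa using hxy
  · rfl
  · split_ifs at hxy with h1
    simp only [h, Option.some.injEq, mul_right_inj] at hxy
    exact absurd hxy.symm h1
  · split_ifs at hxy with h1
    simp only [h, Option.some.injEq, mul_right_inj] at hxy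
    exact absurd hxy h1
  · split_ifs at hxy with h1 h2
    · rw [h1, h2]
    · simpa using hxy

lemma prolong_col (θ η : G ≃ G) (h : ∀ a, η a = a * θ a) (j : Option G) :
    Function.Injective (fun i => prolong θ η i j) := by
  intro x y hxy
  rcases j with _ | a <;> rcases x with _ | b <;> rcases y with _ | c <;>
    simp only [prolong] at hxy
  · rfl
  · simp at hxy
  · simp at hxy
  · simpa using hxy
  · rfl
  · split_ifs at hxy with h1
    simp only [h, Option.some.injEq, Equiv.apply_symm_apply, mul_left_inj] at hxy
    exact absurd (by rw [← hxy]; simp) h1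
  · split_ifs at hxy with h1
    simp only [h, Option.some.injEq, Equiv.apply_symm_apply, mul_left_inj] at hxy
    exact absurd (by rw [hxy]; simp) h1
  · split_ifs at hxy with h1 h2
    · rw [θ.injective (h1.symm.trans h2)]
    · simpa using hxy

/-- The exceptional cells. -/
def badCells (θ : G ≃ G) : Finset (Option G × Option G) :=
  (Finset.univ.image fun j : Option G => ((none : Option G), j)) ∪
    ((Finset.univ.image fun a : G => (some a, (none : Option G))) ∪
      (Finset.univ.image fun a : G => (some a, some (θ a))))

lemma badCells_card (θ : G ≃ G) : (badCells θ).card ≤ 3 * Fintype.card G + 1 := by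
  have h1 := Finset.card_image_le (s := Finset.univ)
    (f := fun j : Option G => ((none : Option G), j))
  have h2 := Finset.card_image_le (s := Finset.univ)
    (f := fun a : G => (some a, (none : Option G)))
  have h3 := Finset.card_image_le (s := Finset.univ)
    (f := fun a : G => (some a, some (θ a)))
  have h4 := Finset.card_union_le (Finset.univ.image fun j : Option G => ((none : Option G), j))
    ((Finset.univ.image fun a : G => (some a, (none : Option G))) ∪
      (Finset.univ.image fun a : G => (some a, some (θ a))))
  have h5 := Finset.card_union_le (Finset.univ.image fun a : G => (some a, (none : Option G)))
      (Finset.univ.image fun a : G => (some a, some (θ a)))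
  simp only [Finset.card_univ, Fintype.card_option] at h1 h2 h3
  unfold badCells
  omega

lemma prolong_count (θ η : G ≃ G) (h : ∀ a, η a = a * θ a) (T : Finset G)
    (hT : ∀ t ∈ T, t * t = 1 ∧ t ≠ 1) (i j : Option G) (hij : (i, j) ∉ badCells θ) :
    T.card - 3 ≤ (Finset.univ.filter fun p : Option G × Option G =>
      p.1 ≠ i ∧ p.2 ≠ j ∧ prolong θ η p.1 p.2 = prolong θ η i j ∧
        prolong θ η i p.2 = prolong θ η p.1 j).card := by
  rcases i with _ | a
  · simp [badCells] at hij
  rcases j with _ | b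
  · simp [badCells] at hij
  have hb : b ≠ θ a := by
    rintro rfl
    simp [badCells] at hij
  let S : Finset G := {θ a * b⁻¹, a⁻¹ * θ.symm b, a⁻¹ * η.symm (a * b)}
  have hS : S.card ≤ 3 := Finset.card_le_three
  have h1 : T.card - 3 ≤ (T \ S).card := by
    have := Finset.le_card_sdiff S T
    omega
  refine h1.trans ?_
  refine Finset.card_le_card_of_injOn (fun t => (some (a * t), some (t * b))) ?_ ?_
  · intro t ht
    simp only [Finset.coe_sdiff, Set.mem_sdiff, Finset.mem_coe, S, Finset.mem_insert,
      Finset.mem_singleton, not_or] at ht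
    obtain ⟨htT, n1, n2, n3⟩ := ht
    obtain ⟨q1, q2⟩ := hT t htT
    have e1 : a * t * (t * b) = a * b := by
      rw [mul_assoc, ← mul_assoc t t b, q1, one_mul]
    have m1 : t * b ≠ θ a := fun e => n1 (by rw [← e]; simp)
    have m2 : b ≠ θ (a * t) := fun e => n2 (by
      have : θ.symm b = a * t := by rw [Equiv.symm_apply_eq]; exact e
      rw [this]; simp)
    have m3 : t * b ≠ θ (a * t) := fun e => n3 (by
      have : η.symm (a * b) = a * t := by rw [Equiv.symm_apply_eq, h, ← e, e1]
      rw [this]; simp)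
    simp [prolong, m1, m2, m3, hb, e1, q2, mul_assoc]
  · intro t _ u _ htu
    simpa using htu

end Prolong

section Dihedral

lemma val_lt_shift (k : ℕ) (hk : 0 < k) (u : ZMod (2 * k)) :
    ((k : ZMod (2 * k)) + u).val < k ↔ ¬ u.val < k := by
  have : NeZero (2 * k) := ⟨by omega⟩
  have hu := ZMod.val_lt u
  have hkv : (k : ZMod (2 * k)).val = k := ZMod.val_natCast_of_lt (by omega)
  rw [ZMod.val_add, hkv]
  by_cases h : u.val < k
  · rw [Nat.mod_eq_of_lt (by omega)]; omega
  · rw [Nat.mod_eq_sub_mod (by omega), Nat.mod_eq_of_lt (by omega)]; omega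

lemma two_mul_inj (k : ℕ) (hk : 0 < k) (x y : ZMod (2 * k)) (h : 2 * x = 2 * y)
    (hs : x.val < k ↔ y.val < k) : x = y := by
  have : NeZero (2 * k) := ⟨by omega⟩
  have hx := ZMod.val_lt x
  have hy := ZMod.val_lt y
  apply ZMod.val_injective
  rw [← ZMod.natCast_zmod_val x, ← ZMod.natCast_zmod_val y] at h
  have h2 : ((2 * x.val : ℕ) : ZMod (2 * k)) = ((2 * y.val : ℕ) : ZMod (2 * k)) := by
    push_cast; exact h
  rw [ZMod.natCast_eq_natCast_iff] at h2
  have h3 : x.val ≡ y.val [MOD k] := Nat.ModEq.mul_left_cancel' (by norm_num) h2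
  by_cases hxk : x.val < k
  · have hyk := hs.1 hxk
    exact Nat.ModEq.eq_of_lt_of_lt h3 hxk hyk
  · have hyk : ¬ y.val < k := fun q => hxk (hs.2 q)
    have h4 : x.val - k + k ≡ y.val - k + k [MOD k] := by
      rwa [Nat.sub_add_cancel (by omega), Nat.sub_add_cancel (by omega)]
    have h5 := Nat.ModEq.add_right_cancel' k h4
    have := Nat.ModEq.eq_of_lt_of_lt h5 (by omega) (by omega)
    omega

lemma two_mul_ne_one (k : ℕ) (x : ZMod (2 * k)) : 2 * x ≠ 1 := by
  intro h
  have h2 := congrArg (ZMod.castHom (Dvd.intro k rfl : 2 ∣ 2 * k) (ZMod 2)) h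
  rw [map_mul, map_one, map_ofNat] at h2
  have h3 : (2 : ZMod 2) = 0 := rfl
  rw [h3, zero_mul] at h2
  exact absurd h2 (by decide)

/-- A complete mapping of the dihedral group of order `4k`. -/
def dTheta (k : ℕ) : DihedralGroup (2 * k) → DihedralGroup (2 * k)
  | .r x => if x.val < k then .r x else .sr (k - x)
  | .sr x => if (x + 1).val < k then .r (k + (x + 1)) else .sr (-1 - x)

/-- The associated orthomorphism. -/
def dEta (k : ℕ) : DihedralGroup (2 * k) → DihedralGroup (2 * k)
  | .r x => if x.val < k then .r (2 * x) else .sr (k - 2 * x)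
  | .sr x => if (x + 1).val < k then .sr (k + 2 * (x + 1) - 1) else .r (1 - 2 * (x + 1))

lemma dEta_eq (k : ℕ) (a : DihedralGroup (2 * k)) : dEta k a = a * dTheta k a := by
  rcases a with x | x <;> simp only [dEta, dTheta] <;> split_ifs <;> simp <;> ring

lemma dTheta_inj (k : ℕ) (hk : 0 < k) : Function.Injective (dTheta k) := by
  have key : ∀ x y : ZMod (2 * k), x = k + (y + 1) → (x.val < k ↔ ¬ (y + 1).val < k) := by
    rintro x y rfl; exact val_lt_shift k hk _
  rintro (x | x) (y | y) h <;> simp only [dTheta] at h <;> split_ifs at h with h1 h2 h2 <;>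
    simp at h
  · rw [h]
  · rw [h]
  · have := key x y h; tauto
  · have := key x y (by linear_combination -h); tauto
  · have := key y x h.symm; tauto
  · have := key y x (by linear_combination h); tauto
  · rw [h]
  · rw [h]

lemma dEta_inj (k : ℕ) (hk : 0 < k) : Function.Injective (dEta k) := by
  rintro (x | x) (y | y) h <;> simp only [dEta] at h <;> split_ifs at h with h1 h2 h2 <;>
    simp only [DihedralGroup.r.injEq, DihedralGroup.sr.injEq, reduceCtorEq] at h
  · rw [two_mul_inj k hk x y h (by tauto)]
  · rw [two_mul_inj k hk x y (by linear_combination -h) (by tauto)]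
  · exact absurd (by linear_combination h) (two_mul_ne_one k (x + (y + 1)))
  · exact absurd (by linear_combination -h) (two_mul_ne_one k (x + (y + 1)))
  · exact absurd (by linear_combination h) (two_mul_ne_one k (y + (x + 1)))
  · exact absurd (by linear_combination -h) (two_mul_ne_one k (y + (x + 1)))
  · have := two_mul_inj k hk (x + 1) (y + 1) (by linear_combination h) (by tauto)
    rw [add_right_cancel this]
  · have := two_mul_inj k hk (x + 1) (y + 1) (by linear_combination -h) (by tauto)
    rw [add_right_cancel this]

lemma exists_involutions (k : ℕ) (hk : 0 < k) : ∃ T : Finset (DihedralGroup (2 * k)),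
    (∀ t ∈ T, t * t = 1 ∧ t ≠ 1) ∧ T.card = 2 * k + 1 := by
  have : NeZero (2 * k) := ⟨by omega⟩
  let f : Option (ZMod (2 * k)) → DihedralGroup (2 * k)
    | none => .r k
    | some x => .sr x
  have hf : Function.Injective f := by
    rintro (_ | x) (_ | y) h <;> simp_all [f]
  refine ⟨Finset.univ.map ⟨f, hf⟩, ?_, ?_⟩
  · intro t ht
    simp only [Finset.mem_map, Finset.mem_univ, true_and, Function.Embedding.coeFn_mk] at ht
    obtain ⟨_ | x, rfl⟩ := ht
    · simp only [f, DihedralGroup.r_mul_r, DihedralGroup.one_def, ne_eq,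
        DihedralGroup.r.injEq]
      constructor
      · have : ((2 * k : ℕ) : ZMod (2 * k)) = 0 := ZMod.natCast_self _
        push_cast at this
        linear_combination this
      · intro h
        rw [ZMod.natCast_eq_zero_iff] at h
        have := Nat.le_of_dvd hk h
        omega
    · refine ⟨by simp [f], ?_⟩
      rw [DihedralGroup.one_def]
      simp only [f, ne_eq, reduceCtorEq, not_false_eq_true]
  · simp [ZMod.card]

end Dihedral

/-- For `n = 4k + 1` there is a latin square `L` of order `n` and a set `B` of
at most `3n - 2` cells such that every cell outside `B` lies in at least
`2k - 2` distinct 2×2 subsquares of `L`. -/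
theorem exists_odd_order_latin_square_many_intercalates (k : ℕ) (hk : 0 < k) :
    ∃ (L : Fin (4 * k + 1) → Fin (4 * k + 1) → Fin (4 * k + 1))
      (B : Finset (Fin (4 * k + 1) × Fin (4 * k + 1))),
      IsLatinSquare L ∧ B.card ≤ 3 * (4 * k + 1) - 2 ∧
      ∀ i j, (i, j) ∉ B →
        2 * k - 2 ≤ (Finset.univ.filter
          fun p : Fin (4 * k + 1) × Fin (4 * k + 1) =>
            p.1 ≠ i ∧ p.2 ≠ j ∧ L p.1 p.2 = L i j ∧ L i p.2 = L p.1 j).card := by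
  have : NeZero (2 * k) := ⟨by omega⟩
  let θ : DihedralGroup (2 * k) ≃ DihedralGroup (2 * k) :=
    Equiv.ofBijective _ (Finite.injective_iff_bijective.1 (dTheta_inj k hk))
  let η : DihedralGroup (2 * k) ≃ DihedralGroup (2 * k) :=
    Equiv.ofBijective _ (Finite.injective_iff_bijective.1 (dEta_inj k hk))
  have h : ∀ a, η a = a * θ a := dEta_eq k
  obtain ⟨T, hT, hTc⟩ := exists_involutions k hk
  have hG : Fintype.card (DihedralGroup (2 * k)) = 4 * k := by
    rw [DihedralGroup.card]; ring
  let e : Fin (4 * k + 1) ≃ Option (DihedralGroup (2 * k)) :=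
    Fintype.equivOfCardEq (by rw [Fintype.card_option, hG, Fintype.card_fin])
  refine ⟨fun i j => e.symm (prolong θ η (e i) (e j)),
    (badCells θ).map (Equiv.prodCongr e.symm e.symm).toEmbedding, ⟨?_, ?_⟩, ?_, ?_⟩
  · intro i
    refine Finite.injective_iff_bijective.1 ?_
    exact e.symm.injective.comp ((prolong_row θ η h (e i)).comp e.injective)
  · intro j
    refine Finite.injective_iff_bijective.1 ?_
    exact e.symm.injective.comp ((prolong_col θ η h (e j)).comp e.injective)
  · rw [Finset.card_map]
    have := badCells_card θ
    omega
  · intro i j hij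
    have hij' : (e i, e j) ∉ badCells θ := by
      intro hm
      apply hij
      rw [Finset.mem_map]
      exact ⟨(e i, e j), hm, by simp⟩
    have hc := prolong_count θ η h T hT (e i) (e j) hij'
    rw [hTc] at hc
    refine le_trans (by omega) (hc.trans ?_)
    refine Finset.card_le_card_of_injOn (Equiv.prodCongr e.symm e.symm) ?_
      (Equiv.injective _).injOn
    rintro ⟨p, q⟩ hp
    simp only [Finset.coe_filter, Finset.mem_univ, true_and, Set.mem_setOf_eq] at hp
    simp [Equiv.symm_apply_eq, hp]
end

section
/- For every integer k ≥ 3, letting n = 4k − 2, there exists a latin square L' of order n that differs from the Chetwynd–Häggkvist square L_n in at most 12 cells and that possesses a transversal. -/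
/-- Switching the rectangle with rows `a, c` and columns `b, d`. -/
def swSq {n : ℕ} (L : Fin n → Fin n → Fin n) (a b c d : Fin n) (i j : Fin n) : Fin n :=
  if j = b ∨ j = d then L (Equiv.swap a c i) j else L i j

theorem swSq_latin {n : ℕ} (L : Fin n → Fin n → Fin n) (hL : IsLatinSquare L)
    (a b c d : Fin n) (h1 : L a b = L c d) (h2 : L a d = L c b) :
    IsLatinSquare (swSq L a b c d) := by
  constructor
  · intro i
    by_cases hi : i = a ∨ i = c
    · have : swSq L a b c d i = L i ∘ Equiv.swap b d := by
        funext j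
        simp only [swSq, Function.comp]
        by_cases hb : j = b
        · subst hb
          rcases hi with rfl | rfl <;> simp [h1, h2]
        · by_cases hd : j = d
          · subst hd
            rcases hi with rfl | rfl <;> simp [h1, h2]
          · simp [hb, hd, Equiv.swap_apply_of_ne_of_ne hb hd]
      rw [this]
      exact (hL.1 i).comp (Equiv.bijective _)
    · push Not at hi
      have : swSq L a b c d i = L i := by
        funext j
        simp [swSq, Equiv.swap_apply_of_ne_of_ne hi.1 hi.2]
      rw [this]
      exact hL.1 i
  · intro j
    by_cases hj : j = b ∨ j = d
    · have : (fun i => swSq L a b c d i j) = (fun i => L i j) ∘ Equiv.swap a c := by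
        funext i
        simp [swSq, hj]
      rw [this]
      exact (hL.2 j).comp (Equiv.bijective _)
    · have : (fun i => swSq L a b c d i j) = (fun i => L i j) := by
        funext i
        simp [swSq, hj]
      rw [this]
      exact hL.2 j

theorem swSq_card {n : ℕ} (L : Fin n → Fin n → Fin n) (a b c d : Fin n) :
    (Finset.univ.filter fun p : Fin n × Fin n =>
      swSq L a b c d p.1 p.2 ≠ L p.1 p.2).card ≤ 12 := by
  have hsub : (Finset.univ.filter fun p : Fin n × Fin n =>
      swSq L a b c d p.1 p.2 ≠ L p.1 p.2) ⊆ ({a, c} : Finset (Fin n)) ×ˢ {b, d} := by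
    rintro ⟨i, j⟩ hp
    simp only [Finset.mem_filter, Finset.mem_univ, true_and] at hp
    simp only [Finset.mem_product, Finset.mem_insert, Finset.mem_singleton]
    by_cases hj : j = b ∨ j = d
    · refine ⟨?_, hj⟩
      by_contra hi
      push Not at hi
      apply hp
      simp [swSq, Equiv.swap_apply_of_ne_of_ne hi.1 hi.2]
    · exact absurd (by simp [swSq, hj]) hp
  refine (Finset.card_le_card hsub).trans ?_
  rw [Finset.card_product]
  have h1 := Finset.card_le_two (a := a) (b := c)
  have h2 := Finset.card_le_two (a := b) (b := d)
  nlinarith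

/-- Linear form of `x % m` for `x < 3 * m`. -/
def redMod (m x : ℕ) : ℕ := if x < m then x else if x < 2 * m then x - m else x - 2 * m

theorem mod_eq_redMod (m x : ℕ) (h : x < 3 * m) : x % m = redMod m x := by
  unfold redMod
  split_ifs with h1 h2
  · exact Nat.mod_eq_of_lt h1
  · rw [Nat.mod_eq_sub_mod (by omega), Nat.mod_eq_of_lt (by omega)]
  · rw [Nat.mod_eq_sub_mod (by omega), Nat.mod_eq_sub_mod (by omega),
      Nat.mod_eq_of_lt (by omega)]
    omega

theorem CHsq_val (m : ℕ) (i j : Fin (2 * m)) : (CHsq m i j).val =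
    if i.val < m then
      if j.val < m then redMod m (j.val + 2 * m - i.val)
      else m + redMod m (j.val + m - i.val)
    else
      if j.val < m then m + redMod m (i.val + m - j.val)
      else redMod m (i.val + 2 * m - j.val) := by
  have hi := i.isLt
  have hj := j.isLt
  unfold CHsq
  dsimp only
  split_ifs with h1 h2 h2
  · exact mod_eq_redMod _ _ (by omega)
  · have : j.val + 2 * m - i.val = (j.val + m - i.val) + m := by omega
    simp only [this, Nat.add_mod_right]
    rw [mod_eq_redMod _ _ (by omega)]
  · have : i.val + 2 * m - j.val = (i.val + m - j.val) + m := by omega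
    simp only [this, Nat.add_mod_right]
    rw [mod_eq_redMod _ _ (by omega)]
  · exact mod_eq_redMod _ _ (by omega)

set_option maxHeartbeats 4000000 in
theorem CHsq_latin (m : ℕ) : IsLatinSquare (CHsq m) := by
  constructor
  · intro i
    apply Function.Injective.bijective_of_finite
    intro j j' h
    have h := congrArg Fin.val h
    have hi := i.isLt
    have hj := j.isLt
    have hj' := j'.isLt
    simp only [CHsq_val, redMod] at h
    apply Fin.ext
    split_ifs at h <;> omega
  · intro i
    apply Function.Injective.bijective_of_finite
    intro j j' h
    have h := congrArg Fin.val h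
    have hi := i.isLt
    have hj := j.isLt
    have hj' := j'.isLt
    simp only [CHsq_val, redMod] at h
    apply Fin.ext
    split_ifs at h <;> omega

/-- The column chosen in row `i`, for `m = 2 * h + 1`. -/
def sgN (h i : ℕ) : ℕ :=
  if i < 2 * h + 1 then
    if i + 4 ≤ h then (2 * h + 1) + 2 * h - i
    else if i + 3 ≤ h then h + 3
    else if i + 2 ≤ h then h + 2
    else if i + 1 ≤ h then (2 * h + 1) + h - 1
    else if i ≤ h then h
    else if i ≤ h + 1 then h - 1
    else if i ≤ h + 2 then (2 * h + 1) + h - 2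
    else if i ≤ h + 3 then (2 * h + 1) + h - 3
    else 2 * h - i
  else
    if i + 4 ≤ (2 * h + 1) + h then 2 * h - (i - (2 * h + 1))
    else if i + 3 ≤ (2 * h + 1) + h then (2 * h + 1) + h + 3
    else if i + 2 ≤ (2 * h + 1) + h then (2 * h + 1) + h + 2
    else if i + 1 ≤ (2 * h + 1) + h then h + 1
    else if i ≤ (2 * h + 1) + h then h - 2
    else if i ≤ (2 * h + 1) + h + 1 then (2 * h + 1) + h + 1
    else if i ≤ (2 * h + 1) + h + 2 then (2 * h + 1) + h
    else if i ≤ (2 * h + 1) + h + 3 then h - 3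
    else (2 * h + 1) + 2 * h - (i - (2 * h + 1))

/-- The symbol met in row `i`. -/
def syN (h i : ℕ) : ℕ :=
  if i < 2 * h + 1 then
    if i + 4 ≤ h then 4 * h + 1 - 2 * i
    else if i + 3 ≤ h then 6
    else if i + 2 ≤ h then 4
    else if i + 1 ≤ h then 2 * h + 1
    else if i ≤ h then 0
    else if i ≤ h + 1 then 4 * h + 1 - 2 * i
    else if i ≤ h + 2 then 4 * h + 2 - 4
    else if i ≤ h + 3 then 4 * h + 2 - 6
    else 4 * h + 1 - 2 * i
  else
    if i + 4 ≤ (2 * h + 1) + h then 2 * (i - (2 * h + 1)) + 2 * h + 2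
    else if i + 3 ≤ (2 * h + 1) + h then 2 * h + 1 - 6
    else if i + 2 ≤ (2 * h + 1) + h then 2 * h + 1 - 4
    else if i + 1 ≤ (2 * h + 1) + h then 2 * (i - (2 * h + 1)) + 2 * h + 2
    else if i ≤ (2 * h + 1) + h then 2 * h + 1 + 2
    else if i ≤ (2 * h + 1) + h + 1 then 2 * h + 1 + 4
    else if i ≤ (2 * h + 1) + h + 2 then 2
    else if i ≤ (2 * h + 1) + h + 3 then 2 * h + 1 + 6
    else 2 * (i - (2 * h + 1)) - 2 * h

/-- The tabulation of row, column and symbol. -/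
def Tab (h i s y : ℕ) : Prop :=
    ((i + 4 ≤ h) ∧ s + i = 4 * h + 1 ∧ y + 2 * i = 4 * h + 1) ∨
    ((i + 3 = h) ∧ s = h + 3 ∧ y = 6) ∨
    ((i + 2 = h) ∧ s = h + 2 ∧ y = 4) ∨
    ((i + 1 = h) ∧ s = 3 * h ∧ y = 2 * h + 1) ∨
    ((i = h) ∧ s = h ∧ y = 0) ∨
    ((i = h + 1) ∧ s + 1 = h ∧ y + 2 * i = 4 * h + 1) ∨
    ((i = h + 2) ∧ s + 1 = 3 * h ∧ y + 2 = 4 * h) ∨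
    ((i = h + 3) ∧ s + 2 = 3 * h ∧ y + 4 = 4 * h) ∨
    ((h + 4 ≤ i ∧ i < 2 * h + 1) ∧ s + i = 2 * h ∧ y + 2 * i = 4 * h + 1) ∨
    ((2 * h + 1 ≤ i ∧ i + 3 ≤ 3 * h) ∧ s + i = 4 * h + 1 ∧ y + 2 * h = 2 * i) ∨
    ((i + 2 = 3 * h) ∧ s = 3 * h + 4 ∧ y + 5 = 2 * h) ∨
    ((i + 1 = 3 * h) ∧ s = 3 * h + 3 ∧ y + 3 = 2 * h) ∨
    ((i = 3 * h) ∧ s = h + 1 ∧ y = 4 * h) ∨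
    ((i = 3 * h + 1) ∧ s + 2 = h ∧ y = 2 * h + 3) ∨
    ((i = 3 * h + 2) ∧ s = 3 * h + 2 ∧ y = 2 * h + 5) ∨
    ((i = 3 * h + 3) ∧ s = 3 * h + 1 ∧ y = 2) ∨
    ((i = 3 * h + 4) ∧ s + 3 = h ∧ y = 2 * h + 7) ∨
    ((3 * h + 5 ≤ i) ∧ s + i = 6 * h + 2 ∧ y + 6 * h + 2 = 2 * i)

set_option maxHeartbeats 4000000 in
theorem tab_spec (h i : ℕ) (hh : 3 ≤ h) (hi : i < 2 * (2 * h + 1)) :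
    Tab h i (sgN h i) (syN h i) := by
  unfold Tab sgN syN
  split_ifs
  all_goals
    repeat (first | exact Or.inl ⟨by omega, by omega, by omega⟩ | apply Or.inr)
  exact ⟨by omega, by omega, by omega⟩

set_option maxHeartbeats 4000000 in
theorem tab_val (h x s y : ℕ) (hh : 3 ≤ h) (hx : x < 2 * (2 * h + 1))
    (hc : x ≠ 2 * h + 1 + h + 1) (h1 : Tab h x s y) :
    (if x < 2 * h + 1 then
      if s < 2 * h + 1 then redMod (2 * h + 1) (s + 2 * (2 * h + 1) - x)
      else 2 * h + 1 + redMod (2 * h + 1) (s + (2 * h + 1) - x)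
    else
      if s < 2 * h + 1 then 2 * h + 1 + redMod (2 * h + 1) (x + (2 * h + 1) - s)
      else redMod (2 * h + 1) (x + 2 * (2 * h + 1) - s)) = y := by
  unfold redMod
  rcases h1 with h1 | h1 | h1 | h1 | h1 | h1 | h1 | h1 | h1 | h1 | h1 | h1 | h1 | h1 | h1 | h1 |
      h1 | h1 <;> split_ifs <;> omega

theorem sgN_lt (h i : ℕ) (hh : 3 ≤ h) (hi : i < 2 * (2 * h + 1)) :
    sgN h i < 2 * (2 * h + 1) := by
  have h1 := tab_spec h i hh hi
  generalize sgN h i = s at *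
  generalize syN h i = y at *
  rcases h1 with h1 | h1 | h1 | h1 | h1 | h1 | h1 | h1 | h1 | h1 | h1 | h1 | h1 | h1 | h1 | h1 |
      h1 | h1 <;> omega

set_option maxHeartbeats 4000000 in
theorem sgN_inj (h i j : ℕ) (hh : 3 ≤ h) (hi : i < 2 * (2 * h + 1)) (hj : j < 2 * (2 * h + 1))
    (e : sgN h i = sgN h j) : i = j := by
  have h1 := tab_spec h i hh hi
  have h2 := tab_spec h j hh hj
  rw [← e] at h2
  generalize sgN h i = s at *
  generalize syN h i = y at *
  generalize syN h j = z at *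
  clear e
  rcases h1 with ⟨h1, h3, -⟩ | ⟨h1, h3, -⟩ | ⟨h1, h3, -⟩ | ⟨h1, h3, -⟩ | ⟨h1, h3, -⟩ | ⟨h1, h3, -⟩
      | ⟨h1, h3, -⟩ | ⟨h1, h3, -⟩ | ⟨h1, h3, -⟩ | ⟨h1, h3, -⟩ | ⟨h1, h3, -⟩ | ⟨h1, h3, -⟩ | ⟨h1,
      h3, -⟩ | ⟨h1, h3, -⟩ | ⟨h1, h3, -⟩ | ⟨h1, h3, -⟩ | ⟨h1, h3, -⟩ | ⟨h1, h3, -⟩ <;>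
  rcases h2 with ⟨h2, h4, -⟩ | ⟨h2, h4, -⟩ | ⟨h2, h4, -⟩ | ⟨h2, h4, -⟩ | ⟨h2, h4, -⟩ | ⟨h2, h4, -⟩
      | ⟨h2, h4, -⟩ | ⟨h2, h4, -⟩ | ⟨h2, h4, -⟩ | ⟨h2, h4, -⟩ | ⟨h2, h4, -⟩ | ⟨h2, h4, -⟩ | ⟨h2,
      h4, -⟩ | ⟨h2, h4, -⟩ | ⟨h2, h4, -⟩ | ⟨h2, h4, -⟩ | ⟨h2, h4, -⟩ | ⟨h2, h4, -⟩ <;> omega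

set_option maxHeartbeats 4000000 in
theorem syN_inj (h i j : ℕ) (hh : 3 ≤ h) (hi : i < 2 * (2 * h + 1)) (hj : j < 2 * (2 * h + 1))
    (e : syN h i = syN h j) : i = j := by
  have h1 := tab_spec h i hh hi
  have h2 := tab_spec h j hh hj
  rw [← e] at h2
  generalize sgN h i = s at *
  generalize syN h i = y at *
  generalize sgN h j = z at *
  clear e
  rcases h1 with ⟨h1, -, h3⟩ | ⟨h1, -, h3⟩ | ⟨h1, -, h3⟩ | ⟨h1, -, h3⟩ | ⟨h1, -, h3⟩ | ⟨h1, -, h3⟩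
      | ⟨h1, -, h3⟩ | ⟨h1, -, h3⟩ | ⟨h1, -, h3⟩ | ⟨h1, -, h3⟩ | ⟨h1, -, h3⟩ | ⟨h1, -, h3⟩ | ⟨h1,
      -, h3⟩ | ⟨h1, -, h3⟩ | ⟨h1, -, h3⟩ | ⟨h1, -, h3⟩ | ⟨h1, -, h3⟩ | ⟨h1, -, h3⟩ <;>
  rcases h2 with ⟨h2, -, h4⟩ | ⟨h2, -, h4⟩ | ⟨h2, -, h4⟩ | ⟨h2, -, h4⟩ | ⟨h2, -, h4⟩ | ⟨h2, -, h4⟩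
      | ⟨h2, -, h4⟩ | ⟨h2, -, h4⟩ | ⟨h2, -, h4⟩ | ⟨h2, -, h4⟩ | ⟨h2, -, h4⟩ | ⟨h2, -, h4⟩ | ⟨h2,
      -, h4⟩ | ⟨h2, -, h4⟩ | ⟨h2, -, h4⟩ | ⟨h2, -, h4⟩ | ⟨h2, -, h4⟩ | ⟨h2, -, h4⟩ <;> omega

set_option maxHeartbeats 4000000 in
theorem main_large (h : ℕ) (hh : 3 ≤ h) :
    ∃ L' : Fin (2 * (2 * h + 1)) → Fin (2 * (2 * h + 1)) → Fin (2 * (2 * h + 1)),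
      IsLatinSquare L' ∧
      (Finset.univ.filter fun p : Fin (2 * (2 * h + 1)) × Fin (2 * (2 * h + 1)) =>
        L' p.1 p.2 ≠ CHsq (2 * h + 1) p.1 p.2).card ≤ 12 ∧
      ∃ σ : Fin (2 * (2 * h + 1)) → Fin (2 * (2 * h + 1)),
        Function.Bijective σ ∧ Function.Injective fun i => L' i (σ i) := by
  let a : Fin (2 * (2 * h + 1)) := ⟨h - 3, by omega⟩
  let c : Fin (2 * (2 * h + 1)) := ⟨(2 * h + 1) + h + 1, by omega⟩
  refine ⟨swSq (CHsq (2 * h + 1)) a a c c,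
    swSq_latin _ (CHsq_latin _) _ _ _ _ ?_ ?_, swSq_card _ _ _ _ _,
    fun i => ⟨sgN h i, sgN_lt h i hh i.isLt⟩, ?_, ?_⟩
  · apply Fin.ext
    simp only [CHsq_val, redMod, a, c]
    split_ifs <;> omega
  · apply Fin.ext
    simp only [CHsq_val, redMod, a, c]
    split_ifs <;> omega
  · apply Function.Injective.bijective_of_finite
    intro i j e
    exact Fin.ext (sgN_inj h i j hh i.isLt j.isLt (congrArg Fin.val e))
  · have key : ∀ i : Fin (2 * (2 * h + 1)),
        (swSq (CHsq (2 * h + 1)) a a c c i ⟨sgN h i, sgN_lt h i hh i.isLt⟩).val = syN h i := by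
      intro i
      have hi := i.isLt
      have hac : a ≠ c := by
        intro e
        have := congrArg Fin.val e
        simp only [a, c] at this
        omega
      by_cases hc : i = c
      · subst hc
        have hs : sgN h c.val = c.val := by
          simp only [sgN, c]
          split_ifs <;> omega
        simp only [swSq, hs, Equiv.swap_apply_right, or_true, if_true]
        simp only [CHsq_val, redMod, syN, a, c]
        split_ifs <;> omega
      · have hc' : i.val ≠ 2 * h + 1 + h + 1 := fun e => hc (Fin.ext e)
        have : swSq (CHsq (2 * h + 1)) a a c c i ⟨sgN h i, sgN_lt h i hh i.isLt⟩
            = CHsq (2 * h + 1) i ⟨sgN h i, sgN_lt h i hh i.isLt⟩ := by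
          by_cases ha : i = a
          · have hs : sgN h i = h + 3 := by
              have : i.val = h - 3 := congrArg Fin.val ha
              simp only [sgN]
              split_ifs <;> omega
            unfold swSq
            rw [if_neg]
            simp only [Fin.ext_iff, hs, a, c]
            omega
          · simp [swSq, Equiv.swap_apply_of_ne_of_ne ha hc]
        rw [this, CHsq_val]
        dsimp only
        exact tab_val h i _ _ hh hi hc' (tab_spec h i hh hi)
    intro i j e
    have e := congrArg Fin.val e
    simp only [key] at e
    exact Fin.ext (syN_inj h i j hh i.isLt j.isLt e)

/-- For `k ≥ 3` and `n = 4k - 2`, there is a latin square of order `n`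
differing from the Chetwynd–Häggkvist square in at most 12 cells that has a
transversal. -/
theorem exists_near_CHsq_with_transversal (k : ℕ) (hk : 3 ≤ k) :
    ∃ L' : Fin (2 * (2 * k - 1)) → Fin (2 * (2 * k - 1)) → Fin (2 * (2 * k - 1)),
      IsLatinSquare L' ∧
      (Finset.univ.filter fun p : Fin (2 * (2 * k - 1)) × Fin (2 * (2 * k - 1)) =>
        L' p.1 p.2 ≠ CHsq (2 * k - 1) p.1 p.2).card ≤ 12 ∧
      ∃ σ : Fin (2 * (2 * k - 1)) → Fin (2 * (2 * k - 1)),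
        Function.Bijective σ ∧ Function.Injective fun i => L' i (σ i) := by
  rcases Nat.lt_or_ge k 4 with h | h
  · obtain rfl : k = 3 := by omega
    refine ⟨swSq (CHsq 5) 0 0 5 5, swSq_latin _ (CHsq_latin 5) _ _ _ _ (by decide) (by decide),
      swSq_card _ _ _ _ _, ![0, 3, 6, 1, 5, 2, 4, 8, 7, 9], ?_, ?_⟩
    · apply Function.Injective.bijective_of_finite
      decide
    · decide
  · obtain ⟨h', rfl⟩ : ∃ h', k = h' + 1 := ⟨k - 1, by omega⟩
    have e : 2 * (h' + 1) - 1 = 2 * h' + 1 := by omega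
    rw [e]
    exact main_large h' (by omega)
end
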